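/- arXiv:2008.13224 — 3 statements merged into one kernel-verified Lean document; each statement's English description precedes it below -/
import Mathlib

section
/- Every digraph D with minimum out-degree at least 2 contains a subdivision of the digraph \overrightarrow{\overleftarrow{K}}_3 − e, i.e. the biorientation of the triangle with one arc removed. -/
/- Common definitions: digraphs as irreflexive-in-intent relations `V → V → Prop`,
   directed paths as nonempty duplicate-free lists of vertices,
   subdivisions, gadgets, alternating paths and chains, following
   "Subdivisions in digraphs of large out-degree or large dichromatic number". -/

namespace Paper

variable {V : Type*}

/-- `p` is a directed path in the digraph `D`: a nonempty list of pairwise distinct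
vertices in which consecutive vertices are joined by an arc of `D`.
Its length (number of arcs) is `p.length - 1`. -/
def IsDipathList (D : V → V → Prop) (p : List V) : Prop :=
  p ≠ [] ∧ p.Nodup ∧ p.Chain' D

/-- The out-degree of a vertex. -/
noncomputable def outDeg (D : V → V → Prop) (v : V) : ℕ :=
  Set.ncard {w | D v w}

/-- The digraph `D` contains a subdivision of the digraph `F`: there is an injective
embedding `φ` of the branch vertices and, for every arc `(x,y)` of `F`, a directed path
in `D` from `φ x` to `φ y` of length at least one, such that the internal vertices of
these paths avoid the branch vertices and the paths of distinct arcs are internally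
vertex-disjoint. -/
def ContainsSubdivisionOf {W : Type*} (D : V → V → Prop) (F : W → W → Prop) : Prop :=
  ∃ (φ : W → V) (P : W → W → List V),
    Function.Injective φ ∧
    (∀ ⦃x y⦄, F x y → IsDipathList D (P x y) ∧ (P x y).head? = some (φ x) ∧
      (P x y).getLast? = some (φ y) ∧ 2 ≤ (P x y).length ∧
      ∀ z ∈ (P x y).tail.dropLast, ∀ w, φ w ≠ z) ∧
    (∀ ⦃x y x' y'⦄, F x y → F x' y' → (x, y) ≠ (x', y') →
      ∀ z ∈ (P x y).tail.dropLast, z ∉ P x' y')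

/-- As `ContainsSubdivisionOf`, but moreover the subdivision spans exactly
the vertex set `S`. -/
def SpansSubdivisionOf {W : Type*} (D : V → V → Prop) (S : Set V) (F : W → W → Prop) : Prop :=
  ∃ (φ : W → V) (P : W → W → List V),
    Function.Injective φ ∧
    (∀ ⦃x y⦄, F x y → IsDipathList D (P x y) ∧ (P x y).head? = some (φ x) ∧
      (P x y).getLast? = some (φ y) ∧ 2 ≤ (P x y).length ∧
      ∀ z ∈ (P x y).tail.dropLast, ∀ w, φ w ≠ z) ∧
    (∀ ⦃x y x' y'⦄, F x y → F x' y' → (x, y) ≠ (x', y') →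
      ∀ z ∈ (P x y).tail.dropLast, z ∉ P x' y') ∧
    S = Set.range φ ∪ {z | ∃ x y, F x y ∧ z ∈ P x y}

/-- The biorientation of the triangle minus one arc: vertices `0,1,2` and arcs
`(0,1),(1,0),(1,2),(2,1),(0,2)`. -/
def K3e : Fin 3 → Fin 3 → Prop := fun x y =>
  (x, y) = (0, 1) ∨ (x, y) = (1, 0) ∨ (x, y) = (1, 2) ∨ (x, y) = (2, 1) ∨ (x, y) = (0, 2)

/-- The biorientation of the complete graph on four vertices. -/
def K4bi : Fin 4 → Fin 4 → Prop := fun x y => x ≠ y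

/-- The biorientation of the star with four edges (center `0`). -/
def S4bi : Fin 5 → Fin 5 → Prop := fun x y => x ≠ y ∧ (x = 0 ∨ y = 0)

/-- The orientation of the cycle of length `ℓ` (vertex set `ZMod ℓ`) determined by
`σ`: the edge `{x, x+1}` is oriented from `x` to `x+1` if `σ x = true`, and from
`x+1` to `x` otherwise. -/
def CycleOrientation (ℓ : ℕ) (σ : ZMod ℓ → Bool) : ZMod ℓ → ZMod ℓ → Prop :=
  fun x y => (σ x = true ∧ y = x + 1) ∨ (σ y = false ∧ x = y + 1)

/-- The oriented cycle `C_{a,b}` on `2ab` vertices: going around the cycle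
`ZMod (2ab)`, the arcs of the `j`-th block of `b` consecutive edges are oriented
forwards for even `j` and backwards for odd `j`; its sources are `s_j = 2bj`
and its sinks are `t_j = 2bj + b`, joined by `2a` internally disjoint directed
paths of length `b` each. -/
def Cab (a b : ℕ) : ZMod (2 * a * b) → ZMod (2 * a * b) → Prop := fun x y =>
  ∃ i : ℕ, i < 2 * a * b ∧
    (((i / b) % 2 = 0 ∧ x = (i : ZMod (2 * a * b)) ∧ y = ((i + 1 : ℕ) : ZMod (2 * a * b))) ∨
     ((i / b) % 2 = 1 ∧ x = ((i + 1 : ℕ) : ZMod (2 * a * b)) ∧ y = (i : ZMod (2 * a * b))))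

/-- The directed girth of `D` is at least `g`: every directed cycle
(a nonempty duplicate-free list `v :: p` with consecutive arcs and an arc from the
last vertex back to `v`) has length at least `g`. -/
def DirGirthGE (D : V → V → Prop) (g : ℕ) : Prop :=
  ∀ (v : V) (p : List V), (v :: p).Nodup → List.Chain D v (p ++ [v]) → g ≤ p.length + 1

/-- `D` is strongly connected. -/
def StronglyConnected (D : V → V → Prop) : Prop :=
  ∀ u v : V, Relation.ReflTransGen D u v

/-- `D` is strongly `k`-arc-connected: after deleting any set of at most `k-1` arcs,
the digraph remains strongly connected. -/
def StronglyArcConnected (D : V → V → Prop) (k : ℕ) : Prop :=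
  ∀ E : Finset (V × V), E.card < k →
    StronglyConnected (fun u v => D u v ∧ (u, v) ∉ E)

/-- `x` and `y` are consecutive (in this order) in the list `l`. -/
def adjIn (l : List V) (x y : V) : Prop := ∃ l₁ l₂, l = l₁ ++ x :: y :: l₂

/-- A type-I gadget in `D`: a directed cycle `p, q, rest…` of length at least `g`
through the arc `(p,q)`. -/
structure TypeIGadget (D : V → V → Prop) (g : ℕ) where
  p : V
  q : V
  rest : List V
  nodup : (p :: q :: rest).Nodup
  chain : List.Chain D p (q :: (rest ++ [p]))
  glen : g ≤ rest.length + 2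

def TypeIGadget.verts {D : V → V → Prop} {g : ℕ} (G : TypeIGadget D g) : Set V :=
  {x | x ∈ G.p :: G.q :: G.rest}

def TypeIGadget.arcs {D : V → V → Prop} {g : ℕ} (G : TypeIGadget D g) : V → V → Prop :=
  adjIn (G.p :: G.q :: (G.rest ++ [G.p]))

/-- A basic type-II gadget in `D` (with girth parameter `b`): vertices `p, q, r` and a
directed path `P₁` from `r` to `p` of length at least `2b² + b - 2` avoiding `q`,
all of whose vertices send an arc to `q`. -/
structure BasicIIGadget (D : V → V → Prop) (b : ℕ) where
  p : V
  q : V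
  r : V
  P₁ : List V
  path₁ : IsDipathList D P₁
  first₁ : P₁.head? = some r
  last₁ : P₁.getLast? = some p
  len₁ : 2 * b ^ 2 + b - 1 ≤ P₁.length
  hq : q ∉ P₁
  toq : ∀ x ∈ P₁, D x q

def BasicIIGadget.verts {D : V → V → Prop} {b : ℕ} (G : BasicIIGadget D b) : Set V :=
  insert G.q {x | x ∈ G.P₁}

def BasicIIGadget.arcs {D : V → V → Prop} {b : ℕ} (G : BasicIIGadget D b) :
    V → V → Prop :=
  fun x y => adjIn G.P₁ x y ∨ (x ∈ G.P₁ ∧ y = G.q)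

/-- An extended type-II gadget: a basic type-II gadget together with a directed path
`P₂` of length at least `b` ending at `r`, meeting `P₁` only in `r` and avoiding `q`,
such that either the first vertex of `P₂` sends an arc to the second vertex of `P₁`,
or some vertex of `P₁` other than `r` sends an arc to the first vertex of `P₂`. -/
structure ExtIIGadget (D : V → V → Prop) (b : ℕ) where
  p : V
  q : V
  r : V
  P₁ : List V
  path₁ : IsDipathList D P₁
  first₁ : P₁.head? = some r
  last₁ : P₁.getLast? = some p
  len₁ : 2 * b ^ 2 + b - 1 ≤ P₁.length
  hq : q ∉ P₁
  toq : ∀ x ∈ P₁, D x q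
  P₂ : List V
  path₂ : IsDipathList D P₂
  last₂ : P₂.getLast? = some r
  len₂ : b + 1 ≤ P₂.length
  inter : ∀ x ∈ P₁, x ∈ P₂ → x = r
  hq₂ : q ∉ P₂
  extra : (∃ z y, P₂.head? = some z ∧ P₁[1]? = some y ∧ D z y) ∨
          (∃ w z, w ∈ P₁ ∧ w ≠ r ∧ P₂.head? = some z ∧ D w z)

def ExtIIGadget.verts {D : V → V → Prop} {b : ℕ} (G : ExtIIGadget D b) : Set V :=
  insert G.q ({x | x ∈ G.P₁} ∪ {x | x ∈ G.P₂})

def ExtIIGadget.arcs {D : V → V → Prop} {b : ℕ} (G : ExtIIGadget D b) : V → V → Prop :=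
  fun x y => adjIn G.P₁ x y ∨ (x ∈ G.P₁ ∧ y = G.q) ∨ adjIn G.P₂ x y ∨
    (D x y ∧ ((G.P₂.head? = some x ∧ G.P₁[1]? = some y) ∨
              (x ∈ G.P₁ ∧ x ≠ G.r ∧ G.P₂.head? = some y)))

/-- A type-III gadget: vertices `p, q, r`, the arc `(p,q)`, and two internally
vertex-disjoint directed paths `P₁ : p → r` and `P₂ : q → r`, each of length at
least `2b - 1`. -/
structure TypeIIIGadget (D : V → V → Prop) (b : ℕ) where
  p : V
  q : V
  r : V
  arc : D p q
  P₁ : List V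
  P₂ : List V
  path₁ : IsDipathList D P₁
  path₂ : IsDipathList D P₂
  first₁ : P₁.head? = some p
  first₂ : P₂.head? = some q
  last₁ : P₁.getLast? = some r
  last₂ : P₂.getLast? = some r
  len₁ : 2 * b ≤ P₁.length
  len₂ : 2 * b ≤ P₂.length
  inter : ∀ x ∈ P₁, x ∈ P₂ → x = r

def TypeIIIGadget.verts {D : V → V → Prop} {b : ℕ} (G : TypeIIIGadget D b) : Set V :=
  {x | x ∈ G.P₁} ∪ {x | x ∈ G.P₂}

def TypeIIIGadget.arcs {D : V → V → Prop} {b : ℕ} (G : TypeIIIGadget D b) :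
    V → V → Prop :=
  fun x y => (x = G.p ∧ y = G.q) ∨ adjIn G.P₁ x y ∨ adjIn G.P₂ x y

/-- A trivial gadget: just the arc `(p,q)`. -/
structure TrivGadget (D : V → V → Prop) where
  p : V
  q : V
  arc : D p q

def TrivGadget.verts {D : V → V → Prop} (G : TrivGadget D) : Set V := {G.p, G.q}

def TrivGadget.arcs {D : V → V → Prop} (G : TrivGadget D) : V → V → Prop :=
  fun x y => x = G.p ∧ y = G.q

/-- An `(a,b)`-alternating path in `D` (with 0-based indexing): vertices
`s 0, …, s (a-1)`, `t 0, …, t (a-1)` and pairwise internally disjoint directed paths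
`Q i : s i → t i` and `Q' i : s (i+1) → t i`, forming an oriented path; every `Q' i`
and every `Q i` with `0 < i < a - 1` has length at least `b` (`Q 0` and `Q (a-1)`
may even be single vertices). -/
structure AltPath (D : V → V → Prop) (a b : ℕ) where
  s : Fin a → V
  t : Fin a → V
  Q : Fin a → List V
  Q' : Fin (a - 1) → List V
  path_Q : ∀ i, IsDipathList D (Q i)
  first_Q : ∀ i, (Q i).head? = some (s i)
  last_Q : ∀ i, (Q i).getLast? = some (t i)
  path_Q' : ∀ i, IsDipathList D (Q' i)
  first_Q' : ∀ i : Fin (a - 1),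
    (Q' i).head? = some (s ⟨i.val + 1, by have := i.isLt; omega⟩)
  last_Q' : ∀ i : Fin (a - 1),
    (Q' i).getLast? = some (t ⟨i.val, by have := i.isLt; omega⟩)
  len_Q : ∀ i : Fin a, 0 < i.val → i.val < a - 1 → b + 1 ≤ (Q i).length
  len_Q' : ∀ i, b + 1 ≤ (Q' i).length
  disj_QQ : ∀ i j : Fin a, i ≠ j → ∀ x ∈ Q i, x ∉ Q j
  disj_Q'Q' : ∀ i j : Fin (a - 1), i ≠ j → ∀ x ∈ Q' i, x ∉ Q' j
  disj_QQ' : ∀ (i : Fin a) (j : Fin (a - 1)), ∀ x ∈ Q i, x ∈ Q' j →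
    (j.val = i.val ∧ x = t i) ∨ (i.val = j.val + 1 ∧ x = s i)

def AltPath.verts {D : V → V → Prop} {a b : ℕ} (R : AltPath D a b) : Set V :=
  {x | (∃ i, x ∈ R.Q i) ∨ (∃ i, x ∈ R.Q' i)}

/-- A strong alternating path: additionally `Q 0` and `Q (a-1)` (hence all `Q i`)
have length at least `b`. -/
def AltPath.Strong {D : V → V → Prop} {a b : ℕ} (R : AltPath D a b) : Prop :=
  ∀ i, b + 1 ≤ (R.Q i).length

def AltPath.arcs {D : V → V → Prop} {a b : ℕ} (R : AltPath D a b) : V → V → Prop :=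
  fun x y => (∃ i, adjIn (R.Q i) x y) ∨ (∃ i, adjIn (R.Q' i) x y)

/-- A gadget allowed in a chain: type I (with `g = 4b²`), basic type II, or type III. -/
inductive ChainGadget (D : V → V → Prop) (b : ℕ) where
  | I : TypeIGadget D (4 * b ^ 2) → ChainGadget D b
  | II : BasicIIGadget D b → ChainGadget D b
  | III : TypeIIIGadget D b → ChainGadget D b

def ChainGadget.pp {D : V → V → Prop} {b : ℕ} : ChainGadget D b → V
  | .I G => G.p
  | .II G => G.p
  | .III G => G.p

def ChainGadget.qq {D : V → V → Prop} {b : ℕ} : ChainGadget D b → V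
  | .I G => G.q
  | .II G => G.q
  | .III G => G.q

def ChainGadget.verts {D : V → V → Prop} {b : ℕ} : ChainGadget D b → Set V
  | .I G => G.verts
  | .II G => G.verts
  | .III G => G.verts

def ChainGadget.arcs {D : V → V → Prop} {b : ℕ} : ChainGadget D b → V → V → Prop
  | .I G => G.arcs
  | .II G => G.arcs
  | .III G => G.arcs

/-- A chain in `D`: a directed path (spine) `v 0, …, v m`, a set `A2` of spine arcs,
and a gadget for every arc in `A2` (arcs outside `A2` form `A1` and carry trivial
gadgets), such that each gadget has the endpoints of its arc as designated vertices,
meets the spine only in these two vertices, and two distinct gadgets meet only in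
spine vertices. -/
structure GChain (D : V → V → Prop) (b m : ℕ) where
  v : Fin (m + 1) → V
  inj : Function.Injective v
  spine : ∀ i : Fin m, D (v i.castSucc) (v i.succ)
  A2 : Finset (Fin m)
  gad : (i : Fin m) → i ∈ A2 → ChainGadget D b
  hp : ∀ (i : Fin m) (hi : i ∈ A2), (gad i hi).pp = v i.castSucc
  hq : ∀ (i : Fin m) (hi : i ∈ A2), (gad i hi).qq = v i.succ
  hspine : ∀ (i : Fin m) (hi : i ∈ A2) (j : Fin (m + 1)),
    v j ∈ (gad i hi).verts → j = i.castSucc ∨ j = i.succ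
  hdisj : ∀ (i : Fin m) (hi : i ∈ A2) (j : Fin m) (hj : j ∈ A2), i ≠ j →
    ∀ x, x ∈ (gad i hi).verts → x ∈ (gad j hj).verts → ∃ k, x = v k

def GChain.verts {D : V → V → Prop} {b m : ℕ} (C : GChain D b m) : Set V :=
  Set.range C.v ∪ {x | ∃ (i : Fin m) (hi : i ∈ C.A2), x ∈ (C.gad i hi).verts}

def GChain.arcs {D : V → V → Prop} {b m : ℕ} (C : GChain D b m) : V → V → Prop :=
  fun x y => (∃ i : Fin m, x = C.v i.castSucc ∧ y = C.v i.succ) ∨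
    (∃ (i : Fin m) (hi : i ∈ C.A2), (C.gad i hi).arcs x y)

/-- The vertex set of the gadget `G_e` sitting on the `i`-th spine arc
(the trivial gadget for arcs of `A1`). -/
def GChain.gadVerts {D : V → V → Prop} {b m : ℕ} (C : GChain D b m) (i : Fin m) :
    Set V :=
  if h : i ∈ C.A2 then (C.gad i h).verts else {C.v i.castSucc, C.v i.succ}

/-- An arbitrary gadget: trivial, type I (with `g = 4b²`), basic or extended type II,
or type III. -/
inductive GadgetAny (D : V → V → Prop) (b : ℕ) where
  | triv : TrivGadget D → GadgetAny D b
  | I : TypeIGadget D (4 * b ^ 2) → GadgetAny D b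
  | II : BasicIIGadget D b → GadgetAny D b
  | IIext : ExtIIGadget D b → GadgetAny D b
  | III : TypeIIIGadget D b → GadgetAny D b

def GadgetAny.pp {D : V → V → Prop} {b : ℕ} : GadgetAny D b → V
  | .triv G => G.p
  | .I G => G.p
  | .II G => G.p
  | .IIext G => G.p
  | .III G => G.p

def GadgetAny.qq {D : V → V → Prop} {b : ℕ} : GadgetAny D b → V
  | .triv G => G.q
  | .I G => G.q
  | .II G => G.q
  | .IIext G => G.q
  | .III G => G.q

def GadgetAny.verts {D : V → V → Prop} {b : ℕ} : GadgetAny D b → Set V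
  | .triv G => G.verts
  | .I G => G.verts
  | .II G => G.verts
  | .IIext G => G.verts
  | .III G => G.verts

def GadgetAny.arcs {D : V → V → Prop} {b : ℕ} : GadgetAny D b → V → V → Prop
  | .triv G => G.arcs
  | .I G => G.arcs
  | .II G => G.arcs
  | .IIext G => G.arcs
  | .III G => G.arcs

end Paper

namespace Paper

/-- `l` is the list of inner vertices of a directed walk (of length at least one)
from `a` to `b`. -/
def Pth {V : Type*} (D : V → V → Prop) (a b : V) (l : List V) : Prop :=
  List.IsChain D (a :: (l ++ [b]))

section
variable {V : Type*} {D : V → V → Prop}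

theorem pth_nil {a b : V} : Pth D a b [] ↔ D a b := by simp [Pth]

theorem pth_cons {a b c : V} {l : List V} : Pth D a b (c :: l) ↔ D a c ∧ Pth D c b l := by
  simp [Pth]

theorem pth_append {c b : V} {l' : List V} : ∀ {l : List V} {a : V},
    Pth D a b (l ++ c :: l') ↔ Pth D a c l ∧ Pth D c b l' := by
  intro l
  induction l with
  | nil => intro a; simp [pth_cons, pth_nil]
  | cons x l ih => intro a; simp [pth_cons, ih, and_assoc]

theorem pth_short {a b : V} : ∀ (n : ℕ) (l : List V), l.length ≤ n → Pth D a b l →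
    ∃ l' : List V, (∀ x ∈ l', x ∈ l) ∧ Pth D a b l' ∧ l'.Nodup ∧ a ∉ l' ∧ b ∉ l' := by
  intro n
  induction n with
  | zero =>
    intro l hl h
    have : l = [] := by simpa using hl
    subst this
    exact ⟨[], by simp, h, by simp⟩
  | succ n ih =>
    intro l hl h
    by_cases ha : a ∈ l
    · obtain ⟨s, t, rfl⟩ := List.append_of_mem ha
      obtain ⟨l', h1, h2⟩ := ih t (by simp at hl; omega) (pth_append.1 h).2
      exact ⟨l', fun x hx => by simp [h1 x hx], h2⟩
    by_cases hb : b ∈ l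
    · obtain ⟨s, t, rfl⟩ := List.append_of_mem hb
      obtain ⟨l', h1, h2⟩ := ih s (by simp at hl; omega) (pth_append.1 h).1
      exact ⟨l', fun x hx => by simp [h1 x hx], h2⟩
    by_cases hn : l.Nodup
    · exact ⟨l, fun x hx => hx, h, hn, ha, hb⟩
    · obtain ⟨c, hc⟩ := List.exists_duplicate_iff_not_nodup.2 hn
      have : ∃ r s t, l = r ++ c :: (s ++ c :: t) := by
        clear * - hc
        induction hc with
        | cons_mem hm =>
          obtain ⟨s, t, rfl⟩ := List.append_of_mem hm
          exact ⟨[], s, t, rfl⟩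
        | cons_duplicate _ ih =>
          obtain ⟨r, s, t, rfl⟩ := ih
          exact ⟨_ :: r, s, t, rfl⟩
      obtain ⟨r, s, t, rfl⟩ := this
      have h1 := pth_append.1 h
      have h2 := pth_append.1 h1.2
      obtain ⟨l', h1, h2⟩ := ih (r ++ c :: t) (by simp at hl ⊢; omega)
        (pth_append.2 ⟨h1.1, h2.2⟩)
      refine ⟨l', fun x hx => ?_, h2⟩
      have := h1 x hx
      simp at this ⊢
      tauto

/-- first hit of the set `X` -/
theorem pth_first {b : V} (X : Set V) (hb : b ∈ X) : ∀ (l : List V) (a : V), Pth D a b l →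
    ∃ c ∈ X, (c = b ∨ c ∈ l) ∧ ∃ l', Pth D a c l' ∧ ∀ x ∈ l', x ∈ l ∧ x ∉ X := by
  intro l
  induction l with
  | nil => intro a h; exact ⟨b, hb, Or.inl rfl, [], h, by simp⟩
  | cons y l ih =>
    intro a h
    rw [pth_cons] at h
    by_cases hy : y ∈ X
    · exact ⟨y, hy, by simp, [], pth_nil.2 h.1, by simp⟩
    · obtain ⟨c, hc, h1, l', h2, h3⟩ := ih y h.2
      refine ⟨c, hc, ?_, y :: l', pth_cons.2 ⟨h.1, h2⟩, ?_⟩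
      · simp; tauto
      · intro x hx
        rcases List.mem_cons.1 hx with rfl | hx
        · simp [hy]
        · have := h3 x hx
          simp; tauto

/-- last exit from the set `X` -/
theorem pth_last {b : V} (X : Set V) : ∀ (l : List V) (a : V), a ∈ X → Pth D a b l →
    ∃ c ∈ X, (c = a ∨ c ∈ l) ∧ ∃ l', Pth D c b l' ∧ ∀ x ∈ l', x ∈ l ∧ x ∉ X := by
  intro l
  induction h : l.length using Nat.strong_induction_on generalizing l with
  | _ n ih =>
    intro a ha hp
    by_cases hX : ∃ c ∈ l, c ∈ X
    · obtain ⟨c, hc, hcX⟩ := hX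
      obtain ⟨s, t, rfl⟩ := List.append_of_mem hc
      obtain ⟨d, hd, h1, l', h2, h3⟩ := ih t.length (by simp at h; omega) t rfl c hcX
        (pth_append.1 hp).2
      refine ⟨d, hd, ?_, l', h2, fun x hx => ?_⟩
      · simp; tauto
      · have := h3 x hx
        simp; tauto
    · push Not at hX
      exact ⟨a, ha, Or.inl rfl, l, hp, fun x hx => ⟨hx, hX x hx⟩⟩

theorem pth_dipath {a b : V} {l : List V} (h : Pth D a b l) (hn : l.Nodup) (ha : a ∉ l)
    (hb : b ∉ l) (hab : a ≠ b) : IsDipathList D (a :: (l ++ [b])) := by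
  refine ⟨by simp, ?_, h⟩
  rw [List.nodup_cons, List.nodup_append]
  refine ⟨by simp [ha, hab], hn, by simp, ?_⟩
  intro x hx y hy
  simp at hy
  rintro rfl
  exact hb (hy ▸ hx)

/-- Assembling the subdivision. -/
theorem assemble {u v w : V} (huv : u ≠ v) (hvw : v ≠ w) (huw : u ≠ w)
    (p : Fin 3 → Fin 3 → List V)
    (h : ∀ x y, K3e x y → Pth D (![u, v, w] x) (![u, v, w] y) (p x y) ∧ (p x y).Nodup ∧
      u ∉ p x y ∧ v ∉ p x y ∧ w ∉ p x y)
    (hd : ∀ x y x' y', K3e x y → K3e x' y' → (x, y) ≠ (x', y') →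
      ∀ z ∈ p x y, z ∉ p x' y') :
    ContainsSubdivisionOf D K3e := by
  have hinj : Function.Injective ![u, v, w] := by
    intro x y hxy
    fin_cases x <;> fin_cases y <;> simp_all
  have hmem : ∀ l : List V, u ∉ l → v ∉ l → w ∉ l → ∀ z ∈ l, ∀ i, ![u, v, w] i ≠ z := by
    intro l h1 h2 h3 z hz i
    fin_cases i <;> simp <;> rintro rfl <;> contradiction
  refine ⟨![u, v, w], fun x y => ![u, v, w] x :: (p x y ++ [![u, v, w] y]), hinj, ?_, ?_⟩
  · intro x y hxy
    obtain ⟨h1, h2, h3, h4, h5⟩ := h x y hxy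
    have hm := hmem _ h3 h4 h5
    refine ⟨pth_dipath h1 h2 (fun hx => hm _ hx x rfl) (fun hx => hm _ hx y rfl) ?_, by simp,
      ?_, by simp, ?_⟩
    · intro he
      have := hinj he
      subst this
      fin_cases x <;> simp [K3e] at hxy
    · change (![u, v, w] x :: (p x y ++ [![u, v, w] y])).getLast? = some (![u, v, w] y)
      rw [← List.cons_append, List.getLast?_append]; simp
    · simpa using hm
  · intro x y x' y' h1 h2 hne z hz
    have hz' : z ∈ p x y := by simpa using hz
    obtain ⟨_, _, h3, h4, h5⟩ := h x y h1
    have hm := hmem _ h3 h4 h5 z hz'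
    simp only [List.mem_cons, List.mem_append, List.not_mem_nil, or_false, not_or]
    exact ⟨fun e => hm x' e.symm, hd x y x' y' h1 h2 hne z hz', fun e => hm y' e.symm⟩

theorem nodup_join {s t : List V} {c : V} (hs : s.Nodup) (ht : t.Nodup) (h1 : c ∉ s)
    (h2 : c ∉ t) (h : ∀ x ∈ s, x ∉ t) : (s ++ c :: t).Nodup := by
  rw [List.nodup_append, List.nodup_cons]
  refine ⟨hs, ⟨h2, ht⟩, ?_⟩
  intro x hx y hy
  rintro rfl
  rcases List.mem_cons.1 hy with rfl | hy
  · exact h1 hx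
  · exact h x hx hy

theorem nodup_split {s t : List V} {c : V} (h : (s ++ c :: t).Nodup) :
    s.Nodup ∧ t.Nodup ∧ c ∉ s ∧ c ∉ t ∧ ∀ x ∈ s, x ∉ t := by
  rw [List.nodup_append, List.nodup_cons] at h
  obtain ⟨h1, ⟨h2, h3⟩, h4⟩ := h
  exact ⟨h1, h3, fun hc => h4 c hc c (by simp) rfl, h2,
    fun x hx hx' => h4 x hx x (by simp [hx']) rfl⟩

/-- The special case of Menger's theorem which is needed. -/
theorem two_paths (A : Set V) (a z : V) (hz : z ∉ A)
    (hcut : ∀ s ∈ A, s ≠ a → ∃ l, Pth D a z l ∧ ∀ x ∈ l, x ∈ A ∧ x ≠ s) :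
    ∀ (n : ℕ) (f : V) (p q F : List V), F.length = n → f ∈ A → f ≠ a →
      Pth D a f p → Pth D a f q → Pth D f z F →
      p.Nodup → q.Nodup → F.Nodup →
      (∀ x ∈ p, x ∈ A ∧ x ≠ a ∧ x ≠ f ∧ x ∉ q ∧ x ∉ F) →
      (∀ x ∈ q, x ∈ A ∧ x ≠ a ∧ x ≠ f ∧ x ∉ F) →
      (∀ x ∈ F, x ∈ A ∧ x ≠ a ∧ x ≠ f) →
      ∃ p q : List V, Pth D a z p ∧ Pth D a z q ∧ p.Nodup ∧ q.Nodup ∧ q ≠ [] ∧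
        (∀ x ∈ p, x ∈ A ∧ x ≠ a ∧ x ∉ q) ∧ (∀ x ∈ q, x ∈ A ∧ x ≠ a) := by
  intro n
  induction n using Nat.strong_induction_on with
  | _ n ih =>
    intro f p q F hFn hfA hfa hp hq hF np nq nF dp dq dF
    obtain ⟨N, hN, hNA⟩ := hcut f hfA hfa
    obtain ⟨g, hgX, -, N1, hN1, hN1'⟩ := pth_last {x | x = a ∨ x ∈ p ∨ x ∈ q} N a (by simp) hN
    obtain ⟨f', hf'Y, hf'2, N2, hN2, hN2'⟩ := pth_first {x | x ∈ F ∨ x = z} (by simp) N1 g hN1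
    obtain ⟨N3, hN3', hN3, nN3, -, -⟩ := pth_short _ N2 le_rfl hN2
    -- properties of the new segment
    have dN : ∀ x ∈ N3, x ∈ A ∧ x ≠ f ∧ x ≠ a ∧ x ∉ p ∧ x ∉ q ∧ x ∉ F ∧ x ≠ z := by
      intro x hx
      have h1 := hN2' x (hN3' x hx)
      have h2 := hN1' x h1.1
      have h3 := hNA x h2.1
      simp only [Set.mem_ofPred_eq, not_or] at h1 h2
      tauto
    clear hN2' hN3' hN1' hNA hN2 hN1 hN
    -- the new first path, by symmetry assume it is an extension of `p`
    have dNpq0 : ∀ x ∈ N3, x ∉ p ∧ x ∉ q := fun x hx => by have := dN x hx; tauto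
    replace dN : ∀ x ∈ N3, x ∈ A ∧ x ≠ f ∧ x ≠ a ∧ x ∉ F ∧ x ≠ z :=
      fun x hx => by have := dN x hx; tauto
    have key : ∀ p q : List V, Pth D a f p → Pth D a f q → p.Nodup → q.Nodup →
        (∀ x ∈ p, x ∈ A ∧ x ≠ a ∧ x ≠ f ∧ x ∉ q ∧ x ∉ F) →
        (∀ x ∈ q, x ∈ A ∧ x ≠ a ∧ x ≠ f ∧ x ∉ F) →
        (∀ x ∈ N3, x ∉ p ∧ x ∉ q) → (g = a ∨ g ∈ p) →
        ∃ p q : List V, Pth D a z p ∧ Pth D a z q ∧ p.Nodup ∧ q.Nodup ∧ q ≠ [] ∧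
        (∀ x ∈ p, x ∈ A ∧ x ≠ a ∧ x ∉ q) ∧ (∀ x ∈ q, x ∈ A ∧ x ≠ a) := by
      clear hgX hp hq np nq dp dq dNpq0 p q
      intro p q hp hq np nq dp dq dNpq hg
      have hp' : ∃ p', Pth D a f' p' ∧ p'.Nodup ∧ ∀ x ∈ p', x ∈ p ∨ x ∈ N3 := by
        rcases hg with rfl | hg
        · exact ⟨N3, hN3, nN3, fun x hx => Or.inr hx⟩
        · obtain ⟨s, t, rfl⟩ := List.append_of_mem hg
          obtain ⟨n1, n2, n3, n4, n5⟩ := nodup_split np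
          refine ⟨s ++ g :: N3, pth_append.2 ⟨(pth_append.1 hp).1, hN3⟩,
            nodup_join n1 nN3 n3 ?_ ?_, ?_⟩
          · intro h; exact (dNpq g h).1 hg
          · intro x hx h; exact (dNpq x h).1 (by simp [hx])
          · intro x hx
            simp at hx ⊢
            tauto
      obtain ⟨p', hp', np', dp'⟩ := hp'
      have dp'' : ∀ x ∈ p', x ∈ A ∧ x ≠ a ∧ x ≠ f ∧ x ∉ q ∧ x ∉ F := by
        intro x hx
        rcases dp' x hx with h | h
        · have := dp x h; tauto
        · have := dN x h
          have := dNpq x h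
          tauto
      rcases hf'Y with hf'F | rfl
      · obtain ⟨F1, F2, rfl⟩ := List.append_of_mem hf'F
        obtain ⟨n1, n2, n3, n4, n5⟩ := nodup_split nF
        obtain ⟨c1, c2⟩ := pth_append.1 hF
        have hff := dF f' hf'F
        refine ih F2.length (by simp at hFn; omega) f' p' (q ++ f :: F1) F2 rfl hff.1 hff.2.1
          hp' (pth_append.2 ⟨hq, c1⟩) c2 np' (nodup_join nq n1 ?_ ?_ ?_) n2 ?_ ?_ ?_
        · intro h; exact (dq f h).2.2.1 rfl
        · intro h; exact (dF f (by simp [h])).2.2 rfl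
        · intro x hx h; exact (dq x hx).2.2.2 (by simp [h])
        · intro x hx
          have := dp'' x hx
          simp at this ⊢
          tauto
        · intro x hx
          simp only [List.mem_append, List.mem_cons] at hx dq dF
          rcases hx with hx | rfl | hx
          · have := dq x hx
            tauto
          · refine ⟨hfA, hfa, Ne.symm hff.2.2, fun h => (dF x (by simp [h])).2.2 rfl⟩
          · have := dF x (by simp [hx])
            refine ⟨this.1, this.2.1, ?_, n5 x hx⟩
            rintro rfl
            exact n3 hx
        · intro x hx
          have := dF x (by simp [hx])
          refine ⟨this.1, this.2.1, ?_⟩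
          rintro rfl
          exact n4 hx
      · refine ⟨p', q ++ f :: F, hp', pth_append.2 ⟨hq, hF⟩, np', nodup_join nq nF ?_ ?_ ?_,
          by simp, ?_, ?_⟩
        · intro h; exact (dq f h).2.2.1 rfl
        · intro h; exact (dF f h).2.2 rfl
        · intro x hx h; exact (dq x hx).2.2.2 h
        · intro x hx
          have := dp'' x hx
          simp at this ⊢
          tauto
        · intro x hx
          simp only [List.mem_append, List.mem_cons] at hx
          rcases hx with hx | rfl | hx
          · have := dq x hx
            tauto
          · exact ⟨hfA, hfa⟩
          · have := dF x hx
            tauto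
    rcases hgX with h | h | h
    · exact key p q hp hq np nq dp dq (fun x hx => by have := dNpq0 x hx; tauto) (Or.inl h)
    · exact key p q hp hq np nq dp dq (fun x hx => by have := dNpq0 x hx; tauto) (Or.inr h)
    · refine key q p hq hp nq np (fun x hx => ?_) (fun x hx => ?_)
        (fun x hx => by have := dNpq0 x hx; tauto) (Or.inr h)
      · have := dq x hx
        have h' : x ∉ p := fun hxp => (dp x hxp).2.2.2.1 hx
        tauto
      · have := dp x hx
        tauto

/-- The final configuration. -/
theorem final_step (A : Set V) (a z : V) (hz : z ∉ A) (ha : a ∈ A) (Q p q R : List V) (r : V)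
    (hQ : Pth D z a Q) (dQ : ∀ x ∈ Q, x ∉ A ∧ x ≠ z)
    (hp : Pth D a z p) (hq : Pth D a z q) (np : p.Nodup) (nq : q.Nodup)
    (dp : ∀ x ∈ p, x ∈ A ∧ x ≠ a ∧ x ∉ q) (dq : ∀ x ∈ q, x ∈ A ∧ x ≠ a)
    (hr : r ∈ p) (hR : Pth D r a R) (dR : ∀ x ∈ R, x ∈ A ∧ x ∉ p ∧ x ∉ q) :
    ContainsSubdivisionOf D K3e := by
  obtain ⟨Q', hQ1, hQ2, nQ, hQ3, hQ4⟩ := pth_short _ Q le_rfl hQ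
  obtain ⟨R', hR1, hR2, nR, hR3, hR4⟩ := pth_short _ R le_rfl hR
  replace dQ : ∀ x ∈ Q', x ∉ A ∧ x ≠ z := fun x hx => dQ x (hQ1 x hx)
  replace dR : ∀ x ∈ R', x ∈ A ∧ x ∉ p ∧ x ∉ q := fun x hx => dR x (hR1 x hx)
  have hrA := dp r hr
  obtain ⟨s, t, rfl⟩ := List.append_of_mem hr
  obtain ⟨n1, n2, n3, n4, n5⟩ := nodup_split np
  obtain ⟨c1, c2⟩ := pth_append.1 hp
  have ds : ∀ x ∈ s, x ∈ A ∧ x ≠ a ∧ x ∉ q := fun x hx => dp x (by simp [hx])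
  have dt : ∀ x ∈ t, x ∈ A ∧ x ≠ a ∧ x ∉ q := fun x hx => dp x (by simp [hx])
  have dR2 : ∀ x ∈ R', x ∈ A ∧ x ∉ s ∧ x ∉ t ∧ x ∉ q := by
    intro x hx
    have := dR x hx
    simp at this
    tauto
  have hra : r ≠ a := hrA.2.1
  have hrz : r ≠ z := fun h => hz (h ▸ hrA.1)
  have haz : a ≠ z := fun h => hz (h ▸ ha)
  refine assemble (u := r) (v := a) (w := z) hra haz hrz
    ![![[], R', t], ![s, [], q], ![[], Q', []]] ?_ ?_
  · intro x y hxy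
    rcases hxy with h | h | h | h | h <;> simp only [Prod.mk.injEq] at h <;>
      obtain ⟨rfl, rfl⟩ := h
    · exact ⟨hR2, nR, hR3, hR4, fun h => hz (dR2 z h).1⟩
    · exact ⟨c1, n1, n3, fun h => (ds a h).2.1 rfl, fun h => hz (ds z h).1⟩
    · exact ⟨hq, nq, hrA.2.2, fun h => (dq a h).2 rfl, fun h => hz (dq z h).1⟩
    · exact ⟨hQ2, nQ, fun h => (dQ r h).1 hrA.1, hQ4, hQ3⟩
    · exact ⟨c2, n2, n4, fun h => (dt a h).2.1 rfl, fun h => hz (dt z h).1⟩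
  · intro x y x' y' h1 h2 hne e he
    have f1 : e ∈ R' → e ∉ Q' := fun h h' => (dQ e h').1 (dR2 e h).1
    have f2 : e ∈ R' → e ∉ s := fun h => (dR2 e h).2.1
    have f3 : e ∈ R' → e ∉ t := fun h => (dR2 e h).2.2.1
    have f4 : e ∈ R' → e ∉ q := fun h => (dR2 e h).2.2.2
    have f5 : e ∈ s → e ∉ Q' := fun h h' => (dQ e h').1 (ds e h).1
    have f6 : e ∈ t → e ∉ Q' := fun h h' => (dQ e h').1 (dt e h).1
    have f7 : e ∈ q → e ∉ Q' := fun h h' => (dQ e h').1 (dq e h).1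
    have f8 : e ∈ s → e ∉ t := n5 e
    have f9 : e ∈ s → e ∉ q := fun h => (ds e h).2.2
    have f10 : e ∈ t → e ∉ q := fun h => (dt e h).2.2
    clear dQ dR dR2 ds dt dq dp
    rcases h1 with h | h | h | h | h <;> simp only [Prod.mk.injEq] at h <;>
      obtain ⟨rfl, rfl⟩ := h <;>
    rcases h2 with h | h | h | h | h <;> simp only [Prod.mk.injEq] at h <;>
      obtain ⟨rfl, rfl⟩ := h <;> first
      | exact absurd rfl hne
      | (intro he'
         simp at he he'
         simp [he, he'] at f1 f2 f3 f4 f5 f6 f7 f8 f9 f10)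

theorem main_ind [Fintype V] (hloop : ∀ v, ¬ D v v) (hdeg : ∀ v t, ∃ w, D v w ∧ w ≠ t) :
    ∀ (n : ℕ) (A : Set V) (z a : V) (Q : List V), A.ncard = n → z ∉ A → a ∈ A →
      (∀ x ∈ A, ∀ y, D x y → y ∈ A ∨ y = z) → Pth D z a Q → (∀ x ∈ Q, x ∉ A ∧ x ≠ z) →
      ContainsSubdivisionOf D K3e := by
  intro n
  induction n using Nat.strong_induction_on with
  | _ n ih =>
    intro A z a Q hn hz ha hA hQ dQ
    by_contra hcon
    -- no smaller configuration
    have hmin : ∀ (A' : Set V) (z' a' : V) (Q' : List V), A' ⊆ A → z' ∉ A' → a' ∈ A' →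
        (∀ x ∈ A', ∀ y, D x y → y ∈ A' ∨ y = z') → Pth D z' a' Q' →
        (∀ x ∈ Q', x ∉ A' ∧ x ≠ z') → A' = A := by
      intro A' z' a' Q' hs h1 h2 h3 h4 h5
      by_contra hne
      exact hcon (ih A'.ncard (hn ▸ Set.ncard_lt_ncard (lt_of_le_of_ne hs hne)) A' z' a' Q' rfl
        h1 h2 h3 h4 h5)
    -- strong connectivity of `A`
    have hreach : ∀ x, (x = a ∨ ∃ l, Pth D a x l ∧ ∀ y ∈ l, y ∈ A) → x ∈ A →
        {y | y ∈ A ∧ (y = x ∨ ∃ l, Pth D x y l ∧ ∀ y ∈ l, y ∈ A)} = A := by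
      intro x hx hxA
      set A' := {y | y ∈ A ∧ (y = x ∨ ∃ l, Pth D x y l ∧ ∀ y ∈ l, y ∈ A)} with hA'
      have hxA' : x ∈ A' := ⟨hxA, Or.inl rfl⟩
      have hQ' : ∃ Q', Pth D z x Q' ∧ ∀ y ∈ Q', y ≠ z := by
        rcases hx with rfl | ⟨l, hl, hlA⟩
        · exact ⟨Q, hQ, fun y hy => (dQ y hy).2⟩
        · refine ⟨Q ++ a :: l, pth_append.2 ⟨hQ, hl⟩, ?_⟩
          intro y hy
          simp only [List.mem_append, List.mem_cons] at hy
          rcases hy with hy | rfl | hy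
          · exact (dQ y hy).2
          · rintro rfl; exact hz ha
          · rintro rfl; exact hz (hlA _ hy)
      obtain ⟨Q', hQ', hQz⟩ := hQ'
      obtain ⟨c, hc, -, l, hl, hl'⟩ := pth_first A' hxA' Q' z hQ'
      refine hmin A' z c l (fun y hy => hy.1) (fun h => hz h.1) hc ?_ hl
        (fun y hy => ⟨(hl' y hy).2, hQz y (hl' y hy).1⟩)
      rintro y ⟨hyA, hy⟩ w hw
      rcases hA y hyA w hw with h | h
      · left
        refine ⟨h, Or.inr ?_⟩
        rcases hy with rfl | ⟨l, hl, hlA⟩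
        · exact ⟨[], pth_nil.2 hw, by simp⟩
        · refine ⟨l ++ [y], pth_append.2 ⟨hl, pth_nil.2 hw⟩, ?_⟩
          intro v hv
          simp at hv
          rcases hv with hv | rfl
          · exact hlA v hv
          · exact hyA
      · exact Or.inr h
    have hstrong : ∀ x ∈ A, ∀ b ∈ A, x ≠ b → ∃ l, Pth D x b l ∧ ∀ y ∈ l, y ∈ A := by
      intro x hxA b hb hxb
      have h1 : x = a ∨ ∃ l, Pth D a x l ∧ ∀ y ∈ l, y ∈ A := by
        have h2 := hreach a (Or.inl rfl) ha
        rw [← h2] at hxA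
        exact hxA.2
      have h2 := hreach x h1 hxA
      rw [← h2] at hb
      rcases hb.2 with h | h
      · exact absurd h.symm hxb
      · exact h
    -- no cut vertices
    have hcut : ∀ b ∈ A, ∀ s ∈ A, s ≠ b → ∃ l, Pth D b z l ∧ ∀ x ∈ l, x ∈ A ∧ x ≠ s := by
      intro b hb s hs hsb
      by_contra hno
      set A' := {y | (y ∈ A ∧ y ≠ s) ∧ (y = b ∨ ∃ l, Pth D b y l ∧ ∀ y ∈ l, y ∈ A ∧ y ≠ s)}
        with hA'
      have hbA' : b ∈ A' := ⟨⟨hb, Ne.symm hsb⟩, Or.inl rfl⟩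
      obtain ⟨l, hl, -⟩ := hstrong s hs b hb hsb
      obtain ⟨l, -, hl, -, hls, -⟩ := pth_short _ l le_rfl hl
      obtain ⟨c, hc, -, l', hl', hl''⟩ := pth_first A' hbA' l s hl
      have : A' = A := by
        refine hmin A' s c l' (fun y hy => hy.1.1) (fun h => h.1.2 rfl) hc ?_ hl' ?_
        · rintro y ⟨hyA, hy⟩ w hw
          have hex : ∃ l, Pth D b w l ∧ ∀ y ∈ l, y ∈ A ∧ y ≠ s := by
            rcases hy with rfl | ⟨l, hl, hlA⟩
            · exact ⟨[], pth_nil.2 hw, by simp⟩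
            · refine ⟨l ++ [y], pth_append.2 ⟨hl, pth_nil.2 hw⟩, ?_⟩
              intro v hv
              simp only [List.mem_append, List.mem_singleton] at hv
              rcases hv with hv | rfl
              · exact hlA v hv
              · exact hyA
          rcases hA y hyA.1 w hw with h | rfl
          · by_cases hws : w = s
            · exact Or.inr hws
            · exact Or.inl ⟨⟨h, hws⟩, Or.inr hex⟩
          · exact absurd hex hno
        · intro y hy
          refine ⟨(hl'' y hy).2, ?_⟩
          rintro rfl
          exact hls (hl'' _ hy).1
      rw [← this] at hs
      exact hs.1.2 rfl
    -- two disjoint paths from `a` to `z`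
    obtain ⟨f, haf, hfz⟩ := hdeg a z
    have hfA : f ∈ A := by
      rcases hA a ha f haf with h | h
      · exact h
      · exact absurd h hfz
    have hfa : f ≠ a := by
      rintro rfl
      exact hloop _ haf
    have hF : ∃ F, Pth D f z F ∧ F.Nodup ∧ ∀ x ∈ F, x ∈ A ∧ x ≠ a ∧ x ≠ f := by
      obtain ⟨l, hl, hlA⟩ := hcut f hfA a ha (Ne.symm hfa)
      obtain ⟨F, h1, h2, h3, h4, -⟩ := pth_short _ l le_rfl hl
      refine ⟨F, h2, h3, fun x hx => ?_⟩
      refine ⟨(hlA x (h1 x hx)).1, (hlA x (h1 x hx)).2, ?_⟩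
      rintro rfl
      exact h4 hx
    obtain ⟨F, hF, nF, dF⟩ := hF
    obtain ⟨p, q, hp, hq, np, nq, hqne, dp, dq⟩ := two_paths A a z hz (hcut a ha) F.length f [] [] F rfl
      hfA hfa (pth_nil.2 haf) (pth_nil.2 haf) hF (by simp) (by simp) nF (by simp) (by simp) dF
    obtain ⟨e, he⟩ := List.exists_mem_of_ne_nil q hqne
    obtain ⟨l, hl, hlA⟩ := hstrong e (dq e he).1 a ha (dq e he).2
    obtain ⟨r, hr, -, R, hR, dR⟩ := pth_last {x | x ∈ p ∨ x ∈ q} l e (Or.inr he) hl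
    simp only [Set.mem_ofPred_eq, not_or] at dR hr
    apply hcon
    rcases hr with hr | hr
    · exact final_step A a z hz ha Q p q R r hQ dQ hp hq np nq dp dq hr hR
        (fun x hx => ⟨hlA x (dR x hx).1, (dR x hx).2⟩)
    · refine final_step A a z hz ha Q q p R r hQ dQ hq hp nq np (fun x hx => ?_) (fun x hx => ?_)
        hr hR (fun x hx => ⟨hlA x (dR x hx).1, (dR x hx).2.2, (dR x hx).2.1⟩)
      · exact ⟨(dq x hx).1, (dq x hx).2, fun h => (dp x h).2.2 hx⟩
      · exact ⟨(dp x hx).1, (dp x hx).2.1⟩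

end

/-- Every digraph `D` with minimum out-degree at least `2` contains a
subdivision of the biorientation of the triangle minus one arc. -/
theorem stmt_0 {V : Type*} [Fintype V] [Nonempty V] (D : V → V → Prop)
    (hloop : ∀ v, ¬ D v v) (hdeg : ∀ v, 2 ≤ outDeg D v) :
    ContainsSubdivisionOf D K3e := by
  have hdeg' : ∀ v t, ∃ w, D v w ∧ w ≠ t := by
    intro v t
    exact Set.exists_ne_of_one_lt_ncard (hdeg v) t
  obtain ⟨z⟩ := ‹Nonempty V›
  obtain ⟨a, hza, ha⟩ := hdeg' z z
  refine main_ind hloop hdeg' _ {x | x ≠ z} z a [] rfl (by simp) ha ?_ (pth_nil.2 hza) (by simp)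
  intro x _ y _
  by_cases h : y = z
  · exact Or.inr h
  · exact Or.inl h

end Paper
end

section
/- Let D be a digraph and v_0 ∈ V(D) a vertex such that v_0 has out-degree at least 1 in D and every vertex of D other than v_0 has out-degree at least 2 in D. Then D contains a subdivision of the digraph \overrightarrow{\overleftarrow{K}}_3 − e. -/
namespace Paper

open Classical in
/-- Reachability gives a duplicate-free path. -/
lemma exists_path {V : Type*} {r : V → V → Prop} {Q : V → Prop} (hQ : ∀ u v, r u v → Q u)
    {a b : V} (h : Relation.ReflTransGen r a b) (hb : Q b) :
    ∃ p : List V, p.Nodup ∧ p.IsChain r ∧ p.head? = some a ∧ p.getLast? = some b ∧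
      ∀ v ∈ p, Q v := by
  induction h using Relation.ReflTransGen.head_induction_on with
  | refl => exact ⟨[b], by simp, by simp, by simp, by simp, by simpa using hb⟩
  | @head a c hac _ ih =>
    obtain ⟨p, h1, h2, h3, h4, h5⟩ := ih
    by_cases hap : a ∈ p
    · obtain ⟨l1, l2, rfl⟩ := List.append_of_mem hap
      refine ⟨a :: l2, ?_, ?_, by simp, ?_, ?_⟩
      · exact (List.nodup_append.1 h1).2.1
      · exact (List.isChain_append.1 h2).2.1
      · simpa using h4
      · intro v hv; exact h5 v (by simp at hv ⊢; tauto)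
    · refine ⟨a :: p, by simp [hap, h1], ?_, by simp, ?_, ?_⟩
      · cases p with
        | nil => simp
        | cons d p => simp at h3; subst h3; exact List.isChain_cons_cons.2 ⟨hac, h2⟩
      · cases p with
        | nil => simp at h3
        | cons d p => simpa using h4
      · intro v hv
        rcases List.mem_cons.1 hv with rfl | hv
        · exact hQ _ _ hac
        · exact h5 v hv

lemma sub_mono {V W : Type*} {D D' : V → V → Prop} {F : W → W → Prop}
    (h : ∀ u v, D u v → D' u v) (hs : ContainsSubdivisionOf D F) :
    ContainsSubdivisionOf D' F := by
  obtain ⟨φ, P, h1, h2, h3⟩ := hs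
  refine ⟨φ, P, h1, ?_, h3⟩
  intro x y hxy
  obtain ⟨⟨a, b, c⟩, d⟩ := h2 hxy
  exact ⟨⟨a, b, List.IsChain.imp h c⟩, d⟩

/-- A chain without the consecutive pair `(x,a)` is a chain for the smaller relation. -/
lemma chain_of_not_adj {V : Type*} {D D' : V → V → Prop} {x a : V}
    (h : ∀ u v, D' u v → D u v ∨ (u = x ∧ v = a)) :
    ∀ p : List V, p.IsChain D' → ¬ adjIn p x a → p.IsChain D := by
  intro p
  induction p with
  | nil => simp
  | cons b p ih =>
    intro hc hn
    cases p with
    | nil => simp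
    | cons c p =>
      rw [List.isChain_cons_cons] at hc ⊢
      refine ⟨?_, ih hc.2 ?_⟩
      · rcases h _ _ hc.1 with h | ⟨rfl, rfl⟩
        · exact h
        · exact absurd ⟨[], p, rfl⟩ hn
      · rintro ⟨l1, l2, e⟩
        exact hn ⟨b :: l1, l2, by simp [e]⟩

/-- Every vertex of a chain with at least two vertices is incident to an arc. -/
lemma chain_not_mem {V : Type*} {D : V → V → Prop} {y : V}
    (h : ∀ u v, D u v → u ≠ y ∧ v ≠ y) :
    ∀ p : List V, p.IsChain D → 2 ≤ p.length → y ∉ p := by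
  intro p
  induction p with
  | nil => simp
  | cons b p ih =>
    intro hc hl
    cases p with
    | nil => simp at hl
    | cons c p =>
      rw [List.isChain_cons_cons] at hc
      have := h _ _ hc.1
      cases p with
      | nil => simp; tauto
      | cons d p =>
        have := ih hc.2 (by simp)
        simp at this ⊢; tauto

lemma internal_mem {V : Type*} (l1 l2 : List V) (x y a z : V)
    (h : z ∈ (l1 ++ x :: y :: a :: l2).tail.dropLast) :
    z = y ∨ z ∈ (l1 ++ x :: a :: l2).tail.dropLast := by
  have key : ∀ m : List V, z ∈ (m ++ y :: a :: l2).dropLast →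
      z = y ∨ z ∈ (m ++ a :: l2).dropLast := by
    intro m hm
    rw [List.dropLast_append_of_ne_nil (by simp)] at hm ⊢
    simp at hm ⊢; tauto
  cases l1 with
  | nil => simpa using key [] (by simpa using h)
  | cons b l1 => simpa using key (l1 ++ [x]) (by simpa using h)

open Classical in
/-- Un-suppressing a vertex `y` on the arc `x → a`. -/
lemma sub_lift {V W : Type*} {D D' : V → V → Prop} {F : W → W → Prop}
    (hF : ∀ i, ∃ j, F i j) {x y a : V} (hxy : D x y) (hya : D y a)
    (hy : ∀ u v, D' u v → u ≠ y ∧ v ≠ y)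
    (hD : ∀ u v, D' u v → D u v ∨ (u = x ∧ v = a))
    (hs : ContainsSubdivisionOf D' F) : ContainsSubdivisionOf D F := by
  obtain ⟨φ, P, h1, h2, h3⟩ := hs
  have hyP : ∀ i j, F i j → y ∉ P i j := fun i j hij =>
    chain_not_mem hy _ (h2 hij).1.2.2 (h2 hij).2.2.2.1
  have hyφ : ∀ i, φ i ≠ y := by
    intro i e
    obtain ⟨j, hj⟩ := hF i
    have := List.mem_of_mem_head? (h2 hj).2.1
    exact hyP i j hj (e ▸ this)
  by_cases hex : ∃ i j, F i j ∧ adjIn (P i j) x a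
  swap
  · push Not at hex
    refine ⟨φ, P, h1, ?_, h3⟩
    intro i j hij
    obtain ⟨⟨a, b, c⟩, d⟩ := h2 hij
    exact ⟨⟨a, b, chain_of_not_adj hD _ c (hex i j hij)⟩, d⟩
  obtain ⟨i, j, hij, l1, l2, e⟩ := hex
  have huniq : ∀ i' j', F i' j' → (i, j) ≠ (i', j') → ¬ adjIn (P i' j') x a := by
    rintro i' j' hij' hne ⟨m1, m2, e'⟩
    have hx' : x ∈ P i' j' := by simp [e']
    have ha' : a ∈ P i' j' := by simp [e']
    have hx : x ∈ P i j := by simp [e]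
    have ha : a ∈ P i j := by simp [e]
    have nint : ∀ z, z ∈ (P i j).tail.dropLast → z ∈ P i' j' → False :=
      fun z hz hz' => h3 hij hij' hne z hz hz'
    have nint' : ∀ z, z ∈ (P i' j').tail.dropLast → z ∈ P i j → False :=
      fun z hz hz' => h3 hij' hij (Ne.symm hne) z hz hz'
    have key : ∀ (k1 k2 : List V), x ∉ (k1 ++ x :: a :: k2).tail.dropLast →
        a ∉ (k1 ++ x :: a :: k2).tail.dropLast → k1 = [] ∧ k2 = [] := by
      intro k1 k2 q1 q2
      constructor
      · rcases k1 with _ | ⟨b, k1⟩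
        · rfl
        · exfalso; apply q1
          simp [List.dropLast_append_of_ne_nil]
      · rcases k2 with _ | ⟨b, k2⟩
        · rfl
        · exfalso; apply q2
          rcases k1 with _ | ⟨c, k1⟩ <;> simp [List.dropLast_append_of_ne_nil]
    obtain ⟨rfl, rfl⟩ := key l1 l2 (fun hh => nint x (e ▸ hh) hx') (fun hh => nint a (e ▸ hh) ha')
    obtain ⟨rfl, rfl⟩ := key m1 m2 (fun hh => nint' x (e' ▸ hh) hx)
      (fun hh => nint' a (e' ▸ hh) ha)
    have q1 := (h2 hij).2.1
    have q2 := (h2 hij).2.2.1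
    have q3 := (h2 hij').2.1
    have q4 := (h2 hij').2.2.1
    rw [e] at q1 q2
    rw [e'] at q3 q4
    simp at q1 q2 q3 q4
    exact hne (by rw [h1 (q1.symm.trans q3), h1 (q2.symm.trans q4)])
  let N := l1 ++ x :: y :: a :: l2
  let P' : W → W → List V := fun i' j' => if (i, j) = (i', j') then N else P i' j'
  have hmem : ∀ i' j', F i' j' → ∀ z, z ∈ P' i' j' → z = y ∧ (i, j) = (i', j') ∨ z ∈ P i' j' := by
    intro i' j' hij' z hz
    simp only [P'] at hz
    split_ifs at hz with hh
    · cases hh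
      simp only [N] at hz
      rw [e]; simp at hz ⊢; tauto
    · exact Or.inr hz
  have hint : ∀ i' j', F i' j' → ∀ z, z ∈ (P' i' j').tail.dropLast →
      z = y ∧ (i, j) = (i', j') ∨ z ∈ (P i' j').tail.dropLast := by
    intro i' j' hij' z hz
    simp only [P'] at hz
    split_ifs at hz with hh
    · cases hh
      rw [e]
      rcases internal_mem _ _ _ _ _ _ hz with h | h
      · exact Or.inl ⟨h, rfl⟩
      · exact Or.inr h
    · exact Or.inr hz
  refine ⟨φ, P', h1, ?_, ?_⟩
  · intro i' j' hij'
    have hold := h2 hij'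
    have hlast : ∀ z ∈ (P' i' j').tail.dropLast, ∀ w, φ w ≠ z := by
      intro z hz w
      rcases hint i' j' hij' z hz with ⟨rfl, -⟩ | hz
      · exact hyφ w
      · exact hold.2.2.2.2 z hz w
    refine and_assoc.1 (and_assoc.1 (and_assoc.1 ⟨?_, hlast⟩))
    by_cases hh : (i, j) = (i', j')
    · have hP : P' i' j' = N := if_pos hh
      cases hh
      rw [hP]
      obtain ⟨⟨-, hnd, hch⟩, hhd, hla, hlen, -⟩ := hold
      have hyn := hyP i j hij
      rw [e] at hnd hch hhd hla hyn
      refine ⟨⟨⟨⟨by simp [N], ?_, ?_⟩, ?_⟩, ?_⟩, by simp [N]; omega⟩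
      · have : N.Perm (y :: (l1 ++ x :: a :: l2)) := by
          have := List.perm_middle (a := y) (l₁ := l1 ++ [x]) (l₂ := a :: l2)
          simpa [N] using this
        rw [this.nodup_iff]
        exact List.nodup_cons.2 ⟨hyn, hnd⟩
      · have c1 : (l1 ++ [x]).IsChain D' := by
          have : l1 ++ x :: a :: l2 = (l1 ++ [x]) ++ (a :: l2) := by simp
          have hch' : ((l1 ++ [x]) ++ (a :: l2)).IsChain D' := by rw [← this]; exact hch
          exact (List.isChain_append.1 hch').1
        have c2 : (a :: l2).IsChain D' := by
          have : l1 ++ x :: a :: l2 = (l1 ++ [x]) ++ (a :: l2) := by simp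
          have hch' : ((l1 ++ [x]) ++ (a :: l2)).IsChain D' := by rw [← this]; exact hch
          exact (List.isChain_append.1 hch').2.1
        have hnd' : ((l1 ++ [x]) ++ (a :: l2)).Nodup := by simpa using hnd
        have hdis := (List.nodup_append.1 hnd').2.2
        have d1 : (l1 ++ [x]).IsChain D := by
          refine chain_of_not_adj hD _ c1 ?_
          rintro ⟨k1, k2, ee⟩
          exact hdis a (by rw [ee]; simp) a (by simp) rfl
        have d2 : (a :: l2).IsChain D := by
          refine chain_of_not_adj hD _ c2 ?_
          rintro ⟨k1, k2, ee⟩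
          exact hdis x (by simp) x (by rw [ee]; simp) rfl
        have : N = (l1 ++ [x]) ++ (y :: a :: l2) := by simp [N]
        show N.IsChain D
        rw [this, List.isChain_append]
        refine ⟨d1, List.isChain_cons_cons.2 ⟨hya, d2⟩, ?_⟩
        intro u hu v hv
        simp at hu hv
        subst hu; subst hv; exact hxy
      · cases l1 <;> simpa [N] using hhd
      · simpa [N] using hla
    · have hP : P' i' j' = P i' j' := if_neg hh
      rw [hP]
      obtain ⟨⟨hne, hnd, hch⟩, hhd, hla, hlen, -⟩ := hold
      exact ⟨⟨⟨⟨hne, hnd, chain_of_not_adj hD _ hch (huniq i' j' hij' hh)⟩, hhd⟩, hla⟩, hlen⟩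
  · intro i1 j1 i2 j2 hf1 hf2 hne z hz hz'
    rcases hint _ _ hf1 z hz with ⟨rfl, e1⟩ | q
    · rcases hmem _ _ hf2 _ hz' with ⟨-, e2⟩ | q'
      · exact hne (e1.symm.trans e2)
      · exact hyP _ _ hf2 q'
    · rcases hmem _ _ hf2 _ hz' with ⟨rfl, e2⟩ | q'
      · have : z ∈ (P i1 j1) := List.mem_of_mem_tail (List.mem_of_mem_dropLast q)
        exact hyP _ _ hf1 this
      · exact h3 hf1 hf2 hne z q q'

/-- The explicit subdivision: `x ↔ y`, `x → z`, `y → z` and a path from `z` to `x`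
avoiding `y`. -/
lemma sub_special {V : Type*} {D : V → V → Prop} {x y z : V} (hxy : D x y) (hyx : D y x)
    (hxz : D x z) (hyz : D y z) (n1 : x ≠ y) (n2 : x ≠ z) (n3 : y ≠ z)
    (p : List V) (hnd : p.Nodup) (hch : p.IsChain D) (hhd : p.head? = some z)
    (hla : p.getLast? = some x) (hy : y ∉ p) : ContainsSubdivisionOf D K3e := by
  have hshape : ∃ q, p = z :: (q ++ [x]) := by
    cases p with
    | nil => simp at hhd
    | cons b p =>
      simp at hhd; subst hhd
      rcases List.eq_nil_or_concat p with rfl | ⟨q, c, rfl⟩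
      · simp at hla; exact absurd hla.symm n2
      · refine ⟨q, ?_⟩
        have : (b :: q ++ [c]).getLast? = some x := by simpa using hla
        rw [List.getLast?_append] at this
        simp at this; simp [this]
  obtain ⟨q, rfl⟩ := hshape
  have hq : ∀ v ∈ q, v ≠ x ∧ v ≠ y ∧ v ≠ z := by
    intro v hv
    refine ⟨?_, ?_, ?_⟩ <;> rintro rfl
    · simp [List.nodup_append] at hnd
      exact hnd.2.2 _ hv rfl
    · simp [hv] at hy
    · simp [hv] at hnd
  let φ : Fin 3 → V := ![y, x, z]
  let P : Fin 3 → Fin 3 → List V := fun i j =>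
    if (i, j) = (2, 1) then z :: (q ++ [x]) else [φ i, φ j]
  have hφ : Function.Injective φ := by
    intro i j hij
    fin_cases i <;> fin_cases j <;> simp [φ] at hij ⊢ <;> first | exact absurd hij ‹_› | exact absurd hij.symm ‹_›
  have hin : ∀ i j v, v ∈ (P i j).tail.dropLast → (i, j) = (2, 1) ∧ v ∈ q := by
    intro i j v hv
    simp only [P] at hv
    split_ifs at hv with hh
    · exact ⟨hh, by simpa using hv⟩
    · simp at hv
  refine ⟨φ, P, hφ, ?_, ?_⟩
  · intro i j hij
    refine and_assoc.1 (and_assoc.1 (and_assoc.1 ⟨?_, ?_⟩))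
    · rcases hij with h | h | h | h | h <;> obtain ⟨rfl, rfl⟩ := Prod.mk.inj h
      · exact ⟨⟨⟨⟨by simp [P], by simp [P, φ, n1.symm], List.isChain_pair.2 hyx⟩, by simp [P]⟩, by simp [P]⟩, by simp [P]⟩
      · exact ⟨⟨⟨⟨by simp [P], by simp [P, φ, n1], List.isChain_pair.2 hxy⟩, by simp [P]⟩, by simp [P]⟩, by simp [P]⟩
      · exact ⟨⟨⟨⟨by simp [P], by simp [P, φ, n2], List.isChain_pair.2 hxz⟩, by simp [P]⟩, by simp [P]⟩, by simp [P]⟩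
      · have hP : P 2 1 = z :: (q ++ [x]) := if_pos rfl
        rw [hP]
        exact ⟨⟨⟨⟨by simp, hnd, hch⟩, by simp [φ]⟩, by simpa [φ] using hla⟩, by simp⟩
      · exact ⟨⟨⟨⟨by simp [P], by simp [P, φ, n3], List.isChain_pair.2 hyz⟩, by simp [P]⟩, by simp [P]⟩, by simp [P]⟩
    · intro v hv w e
      have := hq v (hin _ _ _ hv).2
      subst e
      fin_cases w <;> simp [φ] at this
  · intro i j i' j' _ _ hne v hv hv'
    obtain ⟨e, hvq⟩ := hin _ _ _ hv
    have h3 := hq v hvq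
    have : (i', j') ≠ (2, 1) := fun h => hne (e.trans h.symm)
    simp only [P, if_neg this] at hv'
    have hf : ∀ k, v ≠ φ k := by
      intro k; fin_cases k <;> simp [φ, h3]
    simp [hf] at hv'

lemma K3e_out : ∀ i, ∃ j, K3e i j := by
  intro i
  fin_cases i
  · exact ⟨1, by simp [K3e]⟩
  · exact ⟨0, by simp [K3e]⟩
  · exact ⟨1, by simp [K3e]⟩

open Classical in
/-- The main induction, on the number of vertices in the active set `S`. -/
lemma main_aux {V : Type*} : ∀ (n : ℕ) (S : Finset V) (D : V → V → Prop) (v₀ : V),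
    S.card = n → v₀ ∈ S → (∀ u v, D u v → u ∈ S ∧ v ∈ S ∧ u ≠ v) →
    (∃ a, D v₀ a) → (∀ v ∈ S, v ≠ v₀ → ∃ a b, a ≠ b ∧ D v a ∧ D v b) →
    ContainsSubdivisionOf D K3e := by
  intro n
  induction n using Nat.strong_induction_on with
  | _ n IH =>
  intro S D₀ v₀ hn hv₀ hS₀ h1 h2
  have hch : ∀ v, ∃ a b, v ∈ S → D₀ v a ∧ (v ≠ v₀ → a ≠ b ∧ D₀ v b) := by
    intro v
    by_cases hv : v = v₀
    · obtain ⟨a, ha⟩ := h1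
      exact ⟨a, a, fun _ => ⟨hv ▸ ha, fun h => absurd hv h⟩⟩
    · by_cases hvS : v ∈ S
      · obtain ⟨a, b, q⟩ := h2 v hvS hv
        exact ⟨a, b, fun _ => ⟨q.2.1, fun _ => ⟨q.1, q.2.2⟩⟩⟩
      · exact ⟨v, v, fun h => absurd h hvS⟩
  choose f g hfg using hch
  -- prune to exact out-degrees
  obtain ⟨D, hDdef⟩ : ∃ D : V → V → Prop, ∀ u v, D u v ↔
    u ∈ S ∧ (v = f u ∨ (u ≠ v₀ ∧ v = g u)) := ⟨_, fun _ _ => Iff.rfl⟩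
  have hDD : ∀ u v, D u v → D₀ u v := by
    intro u v h
    obtain ⟨hu, rfl | ⟨hu0, rfl⟩⟩ := (hDdef u v).1 h
    · exact (hfg u hu).1
    · exact ((hfg u hu).2 hu0).2
  refine sub_mono hDD ?_
  have hS : ∀ u v, D u v → u ∈ S ∧ v ∈ S ∧ u ≠ v := fun u v h => hS₀ u v (hDD u v h)
  have hf : ∀ u ∈ S, D u (f u) := fun u hu => (hDdef _ _).2 ⟨hu, Or.inl rfl⟩
  have hg : ∀ u ∈ S, u ≠ v₀ → D u (g u) := fun u hu h => (hDdef _ _).2 ⟨hu, Or.inr ⟨h, rfl⟩⟩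
  have hne : ∀ u ∈ S, u ≠ v₀ → f u ≠ g u := fun u hu h => ((hfg u hu).2 h).1
  have hout : ∀ u v, D u v → v = f u ∨ (u ≠ v₀ ∧ v = g u) := fun u v h => ((hDdef u v).1 h).2
  clear hDD hfg h1 h2 hS₀
  -- restriction to proper closed subsets or deletion
  have hdel : ∀ y ∈ S, S.erase y ⊂ S := fun y hy => Finset.erase_ssubset hy
  by_cases hex : ∃ y ∈ S, ∀ x x', D x y → D x' y → x = x'
  · obtain ⟨y, hyS, hy⟩ := hex
    have hcard : (S.erase y).card < n := hn ▸ Finset.card_lt_card (hdel y hyS)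
    have hrest : ∀ w ∈ S.erase y, (∃ a, D w a ∧ a ≠ y) →
        (∀ v ∈ S.erase y, v ≠ w → ∃ a b, a ≠ b ∧ (D v a ∧ a ≠ y) ∧ (D v b ∧ b ≠ y)) →
        ContainsSubdivisionOf D K3e := by
      intro w hw ⟨a, ha, hay⟩ hh
      refine sub_mono (D := fun u v => D u v ∧ u ≠ y ∧ v ≠ y) (fun u v h => h.1) ?_
      refine IH _ hcard (S.erase y) _ w rfl hw ?_ ⟨a, ha, (Finset.mem_erase.1 hw).1, hay⟩ ?_
      · rintro u v ⟨h, hu, hv⟩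
        have := hS u v h
        simp [hu, hv, this]
      · intro v hv hvw
        obtain ⟨a, b, hab, ha, hb⟩ := hh v hv hvw
        have := (Finset.mem_erase.1 hv).1
        exact ⟨a, b, hab, ⟨ha.1, this, ha.2⟩, ⟨hb.1, this, hb.2⟩⟩
    by_cases hyv : y = v₀
    · subst hyv
      by_cases hin : ∃ x, D x y
      · obtain ⟨x, hx⟩ := hin
        have hxS := hS _ _ hx
        refine hrest x (by simp [hxS]) ?_ ?_
        · by_cases e : f x = y
          · exact ⟨g x, hg x hxS.1 hxS.2.2, fun e' => hne x hxS.1 hxS.2.2 (e.trans e'.symm)⟩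
          · exact ⟨f x, hf x hxS.1, e⟩
        · intro v hv hvx
          obtain ⟨hvy, hvS⟩ := Finset.mem_erase.1 hv
          refine ⟨f v, g v, hne v hvS hvy, ⟨hf v hvS, ?_⟩, ⟨hg v hvS hvy, ?_⟩⟩
          · intro e; exact hvx (hy _ _ (e ▸ hf v hvS) hx)
          · intro e; exact hvx (hy _ _ (e ▸ hg v hvS hvy) hx)
      · push Not at hin
        have q := hS _ _ (hf y hyS)
        refine hrest (f y) (by simp [q.2.1, q.2.2.symm]) ?_ ?_
        · exact ⟨f (f y), hf _ q.2.1, fun e => hin _ (e ▸ hf _ q.2.1)⟩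
        · intro v hv hvx
          obtain ⟨hvy, hvS⟩ := Finset.mem_erase.1 hv
          refine ⟨f v, g v, hne v hvS hvy, ⟨hf v hvS, ?_⟩, ⟨hg v hvS hvy, ?_⟩⟩
          · intro e; exact hin _ (e ▸ hf v hvS)
          · intro e; exact hin _ (e ▸ hg v hvS hvy)
    by_cases hin : ∃ x, D x y
    swap
    · push Not at hin
      refine hrest v₀ (by simp [hv₀, Ne.symm hyv]) ?_ ?_
      · exact ⟨f v₀, hf _ hv₀, fun e => hin _ (e ▸ hf _ hv₀)⟩
      · intro v hv hvx
        obtain ⟨hvy, hvS⟩ := Finset.mem_erase.1 hv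
        refine ⟨f v, g v, hne v hvS hvx, ⟨hf v hvS, ?_⟩, ⟨hg v hvS hvx, ?_⟩⟩
        · intro e; exact hin _ (e ▸ hf v hvS)
        · intro e; exact hin _ (e ▸ hg v hvS hvx)
    obtain ⟨x, hx⟩ := hin
    obtain ⟨hxS, -, hxy⟩ := hS _ _ hx
    -- suppression of `y`
    have hsup : ∀ a, D y a → a ≠ x → (x ≠ v₀ → ∃ z, z ≠ a ∧ D x z ∧ z ≠ y) →
        ContainsSubdivisionOf D K3e := by
      intro a ha hax hz
      have hya := hS _ _ ha
      refine sub_lift (D' := fun u v => (D u v ∧ u ≠ y ∧ v ≠ y) ∨ (u = x ∧ v = a))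
        K3e_out hx ha ?_ ?_ ?_
      · rintro u v (h | ⟨rfl, rfl⟩)
        · exact h.2
        · exact ⟨hxy, hya.2.2.symm⟩
      · rintro u v (h | h)
        · exact Or.inl h.1
        · exact Or.inr h
      · refine IH _ hcard (S.erase y) _ v₀ rfl (by simp [hv₀, Ne.symm hyv]) ?_ ?_ ?_
        · rintro u v (⟨h, hu, hv⟩ | ⟨rfl, rfl⟩)
          · have := hS u v h
            simp [hu, hv, this]
          · simp [hxy, hxS, hya.2.1, hya.2.2.symm, hax.symm]
        · by_cases e : f v₀ = y
          · have : v₀ = x := hy _ _ (e ▸ hf _ hv₀) hx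
            exact ⟨a, Or.inr ⟨this, rfl⟩⟩
          · exact ⟨f v₀, Or.inl ⟨hf _ hv₀, Ne.symm hyv, e⟩⟩
        · intro v hv hvv
          obtain ⟨hvy, hvS⟩ := Finset.mem_erase.1 hv
          by_cases hvx : v = x
          · subst hvx
            obtain ⟨z, hza, hvz, hzy⟩ := hz hvv
            exact ⟨z, a, hza, Or.inl ⟨hvz, hvy, hzy⟩, Or.inr ⟨rfl, rfl⟩⟩
          · refine ⟨f v, g v, hne v hvS hvv, Or.inl ⟨hf v hvS, hvy, ?_⟩,
              Or.inl ⟨hg v hvS hvv, hvy, ?_⟩⟩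
            · intro e; exact hvx (hy _ _ (e ▸ hf v hvS) hx)
            · intro e; exact hvx (hy _ _ (e ▸ hg v hvS hvv) hx)
    by_cases hxv : x = v₀
    · by_cases e : f y = x
      · exact hsup (g y) (hg y hyS hyv) (fun e' => hne y hyS hyv (e.trans e'.symm))
          (fun h => absurd hxv h)
      · exact hsup (f y) (hf y hyS) e (fun h => absurd hxv h)
    obtain ⟨z, hxz, hzy⟩ : ∃ z, D x z ∧ z ≠ y := by
      by_cases e : f x = y
      · exact ⟨g x, hg x hxS hxv, fun e' => hne x hxS hxv (e.trans e'.symm)⟩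
      · exact ⟨f x, hf x hxS, e⟩
    by_cases ha : ∃ a, D y a ∧ a ≠ x ∧ a ≠ z
    · obtain ⟨a, ha, hax, haz⟩ := ha
      exact hsup a ha hax (fun _ => ⟨z, haz.symm, hxz, hzy⟩)
    push Not at ha
    have hyxz : D y x ∧ D y z := by
      have q1 := hf y hyS
      have q2 := hg y hyS hyv
      have q3 := hne y hyS hyv
      by_cases e1 : f y = x
      · have e2 : g y = z := ha _ q2 (fun h => q3 (e1.trans h.symm))
        exact ⟨e1 ▸ q1, e2 ▸ q2⟩
      · have e2 := ha _ q1 e1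
        have e3 : g y = x := by
          by_contra h
          exact q3 (e2.trans (ha _ q2 h).symm)
        exact ⟨e3 ▸ q2, e2 ▸ q1⟩
    obtain ⟨hyx, hyz⟩ := hyxz
    obtain ⟨-, hzS, hxz'⟩ := hS _ _ hxz
    let r : V → V → Prop := fun u v => D u v ∧ u ≠ y ∧ v ≠ y
    by_cases hreach : Relation.ReflTransGen r z x
    · obtain ⟨p, p1, p2, p3, p4, p5⟩ := exists_path (Q := fun v => v ≠ y)
        (fun u v h => h.2.1) hreach hxy
      exact sub_special hx hyx hxz hyz hxy hxz' hzy.symm p p1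
        (List.IsChain.imp (fun _ _ h => h.1) p2) p3 p4 (fun h => p5 y h rfl)
    -- closed set of vertices reachable from `z`
    let R : Finset V := S.filter (fun v => Relation.ReflTransGen r z v)
    have hRS : ∀ v ∈ R, v ∈ S := fun v hv => (Finset.mem_filter.1 hv).1
    have hzR : z ∈ R := Finset.mem_filter.2 ⟨hzS, Relation.ReflTransGen.refl⟩
    have hyR : y ∉ R := by
      intro h
      have := (Finset.mem_filter.1 h).2
      rcases Relation.ReflTransGen.cases_tail this with e | ⟨c, -, hc⟩
      · exact hzy e.symm
      · exact hc.2.2 rfl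
    have hcl : ∀ u v, u ∈ R → D u v → v ∈ R := by
      intro u v hu huv
      have hu' := (Finset.mem_filter.1 hu).2
      refine Finset.mem_filter.2 ⟨(hS _ _ huv).2.1, hu'.tail ⟨huv, ?_, ?_⟩⟩
      · rintro rfl; exact hyR hu
      · rintro rfl
        have := hy _ _ huv hx
        subst this
        exact hreach hu'
    have hRc : R.card < n := by
      rw [← hn]
      refine Finset.card_lt_card ⟨hRS, fun h => hyR (h hyS)⟩
    have hfin : ∀ w ∈ R, (∀ v ∈ R, v ≠ w → v ≠ v₀) → ContainsSubdivisionOf D K3e := by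
      intro w hw hww
      refine sub_mono (D := fun u v => D u v ∧ u ∈ R) (fun u v h => h.1) ?_
      refine IH _ hRc R _ w rfl hw ?_ ⟨f w, hf w (hRS w hw), hw⟩ ?_
      · rintro u v ⟨h, hu⟩
        exact ⟨hu, hcl u v hu h, (hS u v h).2.2⟩
      · intro v hv hvw
        have q := hww v hv hvw
        exact ⟨f v, g v, hne v (hRS v hv) q, ⟨hf v (hRS v hv), hv⟩, ⟨hg v (hRS v hv) q, hv⟩⟩
    by_cases h0 : v₀ ∈ R
    · exact hfin v₀ h0 (fun v _ h => h)
    · exact hfin z hzR (fun v hv _ e => h0 (e ▸ hv))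
  · -- double counting
    exfalso
    push Not at hex
    have hcount := Finset.sum_card_bipartiteAbove_eq_sum_card_bipartiteBelow (s := S) (t := S) D
    have hlow : ∑ y ∈ S, 2 ≤ ∑ y ∈ S, (Finset.bipartiteBelow D S y).card := by
      refine Finset.sum_le_sum ?_
      intro y hy
      obtain ⟨x, x', hx, hx', hxx⟩ := hex y hy
      refine Finset.one_lt_card.2 ⟨x, ?_, x', ?_, hxx⟩ <;>
        simp [Finset.mem_bipartiteBelow, hx, hx', (hS _ _ hx).1, (hS _ _ hx').1]
    have hup : ∑ x ∈ S, (Finset.bipartiteAbove D S x).card < ∑ x ∈ S, 2 := by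
      refine Finset.sum_lt_sum ?_ ⟨v₀, hv₀, ?_⟩
      · intro x hx
        refine le_trans (Finset.card_le_card (t := {f x, g x}) ?_) Finset.card_le_two
        intro v hv
        have := hout x v ((Finset.mem_bipartiteAbove D).1 hv).2
        simp; tauto
      · refine lt_of_le_of_lt (Finset.card_le_card (t := {f v₀}) ?_) (by simp)
        intro v hv
        have := hout v₀ v ((Finset.mem_bipartiteAbove D).1 hv).2
        simp; tauto
    omega

/-- If `v₀` has out-degree at least `1` and every other vertex has
out-degree at least `2`, then `D` contains a subdivision of the biorientation of the
triangle minus one arc. -/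
theorem stmt_1 {V : Type*} [Fintype V] (D : V → V → Prop)
    (hloop : ∀ v, ¬ D v v) (v₀ : V) (h₀ : 1 ≤ outDeg D v₀)
    (hdeg : ∀ v, v ≠ v₀ → 2 ≤ outDeg D v) :
    ContainsSubdivisionOf D K3e := by
  classical
  obtain ⟨a, ha⟩ := (Set.ncard_pos (Set.toFinite _)).1 h₀
  refine main_aux _ Finset.univ D v₀ rfl (by simp) ?_ ⟨a, ha⟩ ?_
  · intro u v h
    exact ⟨by simp, by simp, fun e => hloop v (e ▸ h)⟩
  · intro v _ hv
    obtain ⟨a, b, ha, hb, hab⟩ := (Set.one_lt_ncard_iff (Set.toFinite _)).1 (hdeg v hv)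
    exact ⟨a, b, hab, ha, hb⟩

end Paper
end

section
/- There exist absolute constants C > 0 and d ∈ ℕ such that for every integer ℓ ≥ 2, every digraph D with minimum out-degree δ+(D) ≥ C·ℓ^d contains a subdivision of every orientation of the cycle of length ℓ. (Equivalently: there is a polynomially bounded function K : ℕ → ℕ such that every digraph with minimum out-degree at least K(ℓ) contains a subdivision of every orientation of C_ℓ.) -/
namespace Paper

section Aux
open Classical

def sIx {ℓ : ℕ} (σ : ZMod ℓ → Bool) (i : ZMod ℓ) : ZMod ℓ := if σ i = true then i else i + 1
def tIx {ℓ : ℕ} (σ : ZMod ℓ → Bool) (i : ZMod ℓ) : ZMod ℓ := if σ i = true then i + 1 else i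

/-- subdivided cycle inside `S`. -/
def CS {V : Type*} (ℓ : ℕ) (D : V → V → Prop) (S : Finset V) (σ : ZMod ℓ → Bool) : Prop :=
  ∃ (φ : ZMod ℓ → V) (I : ZMod ℓ → List V), Function.Injective φ ∧ (∀ i, φ i ∈ S) ∧
    (∀ i, List.IsChain D (φ (sIx σ i) :: (I i ++ [φ (tIx σ i)]))) ∧
    (∀ i, (I i).Nodup) ∧ (∀ i, ∀ x ∈ I i, x ∈ S ∧ ∀ j, φ j ≠ x) ∧
    (∀ i j, i ≠ j → ∀ x ∈ I i, x ∉ I j)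

theorem CS.mono {V : Type*} {ℓ : ℕ} {D : V → V → Prop} {S T : Finset V} {σ : ZMod ℓ → Bool}
    (h : CS ℓ D S σ) (hST : S ⊆ T) : CS ℓ D T σ := by
  obtain ⟨φ, I, h1, h2, h3, h4, h5, h6⟩ := h
  exact ⟨φ, I, h1, fun i => hST (h2 i), h3, h4, fun i x hx => ⟨hST (h5 i x hx).1, (h5 i x hx).2⟩, h6⟩

/-- contraction of `e` into `t` (keeping in-arcs). -/
def con {V : Type*} (D : V → V → Prop) (e t : V) (u v : V) : Prop := D u v ∨ (v = t ∧ D u e)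

theorem lift_list {V : Type*} {D : V → V → Prop} {e t : V} (het : D e t) (c : V) (I : List V) :
    ∀ a, List.IsChain (con D e t) (a :: (I ++ [c])) → (I ++ [c]).Nodup → e ∉ I →
    List.IsChain D (a :: (I ++ [c])) ∨
    ((∃ I' : List V, List.IsChain D (a :: (I' ++ [c])) ∧ I'.Nodup ∧ ∀ x ∈ I', x ∈ I ∨ x = e) ∧
      (t ∈ I ∨ (c = t ∧ List.IsChain D (a :: (I ++ [e]))))) := by
  induction I with
  | nil =>
    intro a h _ _
    simp only [List.nil_append, List.isChain_cons_cons, List.isChain_singleton, and_true] at h ⊢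
    rcases h with h | ⟨rfl, h⟩
    · exact Or.inl h
    · refine Or.inr ⟨⟨[e], ?_, by simp, by simp⟩, Or.inr ⟨rfl, h⟩⟩
      simp [List.isChain_cons_cons, h, het]
  | cons b I ih =>
    intro a h hn he
    simp only [List.cons_append, List.isChain_cons_cons] at h
    simp only [List.cons_append, List.nodup_cons] at hn
    simp only [List.mem_cons, not_or] at he
    obtain ⟨h1, h2⟩ := h
    obtain ⟨hb, hn⟩ := hn
    have key := ih b h2 hn he.2
    by_cases hbt : b = t
    · subst hbt
      have hg : List.IsChain D (b :: (I ++ [c])) := by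
        rcases key with k | ⟨_, k | ⟨k, _⟩⟩
        · exact k
        · exact absurd (List.mem_append_left _ k) hb
        · exact absurd (by simp [k]) hb
      rcases h1 with h1 | ⟨-, h1⟩
      · left; simp only [List.cons_append, List.isChain_cons_cons]; exact ⟨h1, hg⟩
      · right
        refine ⟨⟨e :: b :: I, ?_, ?_, ?_⟩, Or.inl (by simp)⟩
        · simp only [List.cons_append, List.isChain_cons_cons]; exact ⟨h1, het, hg⟩
        · have := (List.nodup_append.1 hn).1
          simp only [List.nodup_cons, List.mem_cons, not_or]
          exact ⟨⟨he.1, he.2⟩, fun h => hb (List.mem_append_left _ h), this⟩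
        · intro x hx; simp only [List.mem_cons] at hx ⊢; tauto
    · have h1' : D a b := by
        rcases h1 with h1 | ⟨h, -⟩
        · exact h1
        · exact absurd h hbt
      rcases key with k | ⟨⟨I', k1, k2, k3⟩, k⟩
      · left; simp only [List.cons_append, List.isChain_cons_cons]; exact ⟨h1', k⟩
      · right
        refine ⟨⟨b :: I', ?_, ?_, ?_⟩, ?_⟩
        · simp only [List.cons_append, List.isChain_cons_cons]; exact ⟨h1', k1⟩
        · refine List.nodup_cons.2 ⟨fun hbI => ?_, k2⟩
          rcases k3 b hbI with h | h
          · exact hb (List.mem_append_left _ h)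
          · exact he.1 h.symm
        · intro x hx
          rcases List.mem_cons.1 hx with h | h
          · left; simp [h]
          · rcases k3 x h with h | h
            · left; simp [h]
            · exact Or.inr h
        · rcases k with k | ⟨k, k'⟩
          · left; simp [k]
          · right; refine ⟨k, ?_⟩
            simp only [List.cons_append, List.isChain_cons_cons]; exact ⟨h1', k'⟩

theorem tIx_eq {ℓ : ℕ} {σ : ZMod ℓ → Bool} {i j : ZMod ℓ} (hij : i ≠ j)
    (h : tIx σ i = tIx σ j) :
    (∀ m, sIx σ m ≠ tIx σ i) ∧ ∀ m, tIx σ m = tIx σ i → m = i ∨ m = j := by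
  have main : ∀ i j : ZMod ℓ, i ≠ j → σ i = true → tIx σ i = tIx σ j →
     (∀ m, sIx σ m ≠ tIx σ i) ∧ ∀ m, tIx σ m = tIx σ i → m = i ∨ m = j := by
    intro i j hij hi h
    by_cases hj : σ j = true
    · simp only [tIx, hi, hj, if_true] at h
      exact absurd (add_right_cancel h) hij
    · simp only [tIx, hi, hj, if_true] at h
      have h : i + 1 = j := by simpa using h
      subst h
      constructor
      · intro m hm
        by_cases hmm : σ m = true
        · simp only [sIx, tIx, hi, hmm, if_true] at hm
          subst hm; exact hj hmm
        · simp only [sIx, tIx, hi, hmm, if_true] at hm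
          have hm : m + 1 = i + 1 := by simpa using hm
          exact hmm (add_right_cancel hm ▸ hi)
      · intro m hm
        by_cases hmm : σ m = true
        · simp only [tIx, hi, hmm, if_true] at hm
          exact Or.inl (add_right_cancel hm)
        · simp only [tIx, hi, hmm, if_true] at hm
          right; simpa using hm
  by_cases hi : σ i = true
  · exact main i j hij hi h
  · by_cases hj : σ j = true
    · have := main j i hij.symm hj h.symm
      rw [h]
      exact ⟨this.1, fun m hm => (this.2 m hm).symm⟩
    · simp only [tIx, hi, hj] at h
      exact absurd (by simpa using h) hij

theorem sIx_ne_tIx {ℓ : ℕ} (hℓ : 2 ≤ ℓ) (σ : ZMod ℓ → Bool) (i : ZMod ℓ) : sIx σ i ≠ tIx σ i := by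
  have : Fact (1 < ℓ) := ⟨hℓ⟩
  have h1 : (1 : ZMod ℓ) ≠ 0 := one_ne_zero
  unfold sIx tIx
  split_ifs <;> simp

theorem CS.lift {V : Type*} {ℓ : ℕ} {D : V → V → Prop} {S : Finset V} {σ : ZMod ℓ → Bool}
    {e t : V} (he : e ∈ S) (het : D e t) (h : CS ℓ (con D e t) (S.erase e) σ) :
    CS ℓ D S σ := by
  obtain ⟨φ, I, h1, h2, h3, h4, h5, h6⟩ := h
  have hφe : ∀ i, φ i ≠ e := fun i h => by simpa [h] using h2 i
  have hIe : ∀ i, e ∉ I i := fun i h => by simpa using (h5 i e h).1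
  have hφS : ∀ i, φ i ∈ S := fun i => Finset.mem_of_mem_erase (h2 i)
  have hIS : ∀ i, ∀ x ∈ I i, x ∈ S := fun i x hx => Finset.mem_of_mem_erase (h5 i x hx).1
  have hX := fun i => lift_list het (φ (tIx σ i)) (I i) (φ (sIx σ i)) (h3 i) (by
    rw [List.nodup_append]
    refine ⟨h4 i, by simp, ?_⟩
    intro a ha b hb hab
    rw [List.mem_singleton] at hb
    subst hab; exact (h5 i a ha).2 _ hb.symm) (hIe i)
  by_cases hall : ∀ i, List.IsChain D (φ (sIx σ i) :: (I i ++ [φ (tIx σ i)]))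
  · exact ⟨φ, I, h1, hφS, hall, h4, fun i x hx => ⟨hIS i x hx, (h5 i x hx).2⟩, h6⟩
  push Not at hall
  obtain ⟨i, hi⟩ := hall
  obtain ⟨⟨I', k1, k2, k3⟩, k4⟩ := (hX i).resolve_left hi
  by_cases hone : ∀ j, j ≠ i → List.IsChain D (φ (sIx σ j) :: (I j ++ [φ (tIx σ j)]))
  · refine ⟨φ, Function.update I i I', h1, hφS, ?_, ?_, ?_, ?_⟩
    · intro j
      by_cases hj : j = i
      · subst hj; simpa using k1
      · simpa [Function.update_of_ne hj] using hone j hj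
    · intro j
      by_cases hj : j = i
      · subst hj; simpa using k2
      · simpa [Function.update_of_ne hj] using h4 j
    · intro j x hx
      by_cases hj : j = i
      · subst hj
        simp only [Function.update_self] at hx
        rcases k3 x hx with h | h
        · exact ⟨hIS j x h, (h5 j x h).2⟩
        · subst h; exact ⟨he, hφe⟩
      · rw [Function.update_of_ne hj] at hx
        exact ⟨hIS j x hx, (h5 j x hx).2⟩
    · intro j m hjm x hx hx'
      by_cases hj : j = i
      · subst hj
        rw [Function.update_self] at hx
        rw [Function.update_of_ne hjm.symm] at hx'
        rcases k3 x hx with h | h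
        · exact h6 _ _ hjm x h hx'
        · subst h; exact hIe _ hx'
      · rw [Function.update_of_ne hj] at hx
        by_cases hm : m = i
        · subst hm
          rw [Function.update_self] at hx'
          rcases k3 x hx' with h | h
          · exact h6 _ _ hjm x hx h
          · subst h; exact hIe _ hx
        · rw [Function.update_of_ne hm] at hx'
          exact h6 _ _ hjm x hx hx'
  push Not at hone
  obtain ⟨j, hji, hj⟩ := hone
  obtain ⟨-, l4⟩ := (hX j).resolve_left hj
  have hit : φ (tIx σ i) = t ∧ φ (tIx σ j) = t ∧
      List.IsChain D (φ (sIx σ i) :: (I i ++ [e])) ∧ List.IsChain D (φ (sIx σ j) :: (I j ++ [e])) := by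
    rcases k4 with k4 | k4
    · rcases l4 with l4 | l4
      · exact absurd l4 (h6 i j hji.symm t k4)
      · exact absurd l4.1 ((h5 i t k4).2 _)
    · rcases l4 with l4 | l4
      · exact absurd k4.1 ((h5 j t l4).2 _)
      · exact ⟨k4.1, l4.1, k4.2, l4.2⟩
  obtain ⟨hit, hjt, ci, cj⟩ := hit
  have hT := tIx_eq (σ := σ) hji.symm (h1 (hit.trans hjt.symm))
  have htI : ∀ m, t ∉ I m := fun m hm => (h5 m t hm).2 _ hit
  refine ⟨fun x => if φ x = t then e else φ x, I, ?_, ?_, ?_, h4, ?_, h6⟩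
  · intro x y hxy
    by_cases hx : φ x = t <;> by_cases hy : φ y = t <;> simp only [hx, hy, if_true, if_false] at hxy
    · exact h1 (hx.trans hy.symm)
    · exact absurd hxy.symm (hφe y)
    · exact absurd hxy (hφe x)
    · exact h1 hxy
  · intro x
    dsimp only
    split_ifs
    · exact he
    · exact hφS x
  · intro m
    have hs : φ (sIx σ m) ≠ t := fun h => hT.1 m (h1 (h.trans hit.symm))
    dsimp only
    rw [if_neg hs]
    by_cases hm : φ (tIx σ m) = t
    · rw [if_pos hm]
      rcases hT.2 m (h1 (hm.trans hit.symm)) with h | h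
      · subst h; exact ci
      · subst h; exact cj
    · rw [if_neg hm]
      rcases hX m with h | ⟨-, h | h⟩
      · exact h
      · exact absurd h (htI m)
      · exact absurd h.1 hm
  · intro m x hx
    refine ⟨hIS m x hx, fun y => ?_⟩
    dsimp only
    split_ifs
    · rintro rfl; exact hIe _ hx
    · exact (h5 m x hx).2 y

inductive Val {V : Type*} (D : V → V → Prop) (w : V) : List Bool → List (List V) → Prop
  | base (g : V) : D g w → Val D w [] [[g]]
  | cons (u : List Bool) (g : V) (R : List V) (h : V) (R' : List V) (Rs : List (List V)) :
      Val D w u ((h :: R') :: Rs) → List.IsChain (fun x y => D y x) (g :: R) → D g w →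
      (∀ x ∈ g :: R, D x h) →
      Val D w (List.replicate R.length true ++ false :: u) ((g :: R) :: (h :: R') :: Rs)

theorem Val.mono {V : Type*} {D D' : V → V → Prop} (hD : ∀ x y, D x y → D' x y) {w : V}
    {u : List Bool} {Rs : List (List V)} (h : Val D w u Rs) : Val D' w u Rs := by
  induction h with
  | base g h => exact Val.base g (hD _ _ h)
  | cons u g R h R' Rs _ h2 h3 h4 ih =>
    exact Val.cons u g R h R' Rs ih (h2.imp fun _ _ => hD _ _) (hD _ _ h3)
      fun x hx => hD _ _ (h4 x hx)

theorem Val.length {V : Type*} {D : V → V → Prop} {w : V}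
    {u : List Bool} {Rs : List (List V)} (h : Val D w u Rs) :
    Rs.flatten.length = u.length + 1 := by
  induction h with
  | base g h => simp
  | cons u g R h R' Rs _ h2 h3 h4 ih =>
    rw [List.flatten_cons, List.length_append, ih]
    simp; omega

noncomputable def deg {V : Type*} (D : V → V → Prop) (S : Finset V) (v : V) : ℕ :=
  (S.filter (fun x => D v x)).card

theorem deg_con {V : Type*} {D : V → V → Prop} {S : Finset V} {e t v : V} (ht : t ∈ S)
    (hte : t ≠ e) (hv : ¬ (D v e ∧ D v t)) : deg D S v ≤ deg (con D e t) (S.erase e) v := by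
  unfold deg
  apply Finset.card_le_card_of_injOn (fun x => if x = e then t else x)
  · intro x hx
    simp only [Finset.coe_filter, Set.mem_ofPred_eq] at hx
    simp only [Finset.coe_filter, Set.mem_ofPred_eq, Finset.mem_erase]
    split_ifs with h
    · subst h; exact ⟨⟨hte, ht⟩, Or.inr ⟨rfl, hx.2⟩⟩
    · exact ⟨⟨h, hx.1⟩, Or.inl hx.2⟩
  · intro x hx y hy hxy
    simp only [Finset.coe_filter, Set.mem_ofPred_eq] at hx hy
    dsimp only at hxy
    split_ifs at hxy with h1 h2 h2
    · exact h1.trans h2.symm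
    · subst h1 hxy; exact absurd ⟨hx.2, hy.2⟩ hv
    · subst h2 hxy; exact absurd ⟨hy.2, hx.2⟩ hv
    · exact hxy

/-- the state during the search -/
def StC {V : Type*} (k : ℕ) (D : V → V → Prop) (S : Finset V) (u : List Bool) : Prop :=
  k ≤ S.card ∧ ∃ w Rs, Val D w u Rs ∧ (w :: Rs.flatten).Nodup ∧ (∀ x ∈ w :: Rs.flatten, x ∈ S) ∧
    ∀ v ∈ S, v ∉ w :: Rs.flatten → k ≤ deg D S v

def StB {V : Type*} (k : ℕ) (D : V → V → Prop) (S : Finset V) : Prop :=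
  k ≤ S.card ∧ ∃ w ∈ S, ∀ v ∈ S, v ≠ w → k ≤ deg D S v

def StA {V : Type*} (k : ℕ) (D : V → V → Prop) (S : Finset V) : Prop :=
  k ≤ S.card ∧ ∀ v ∈ S, k ≤ deg D S v

theorem deg_le_card {V : Type*} {D : V → V → Prop} {S : Finset V} {v : V} : deg D S v ≤ S.card :=
  Finset.card_filter_le _ _

/-- Contraction, generic bookkeeping. -/
theorem con_aux {V : Type*} {k : ℕ} {D : V → V → Prop} {S : Finset V} {F : List V} {e t : V}
    (hk : k ≤ S.card) (hF : F.length < k) (ht : t ∈ S) (hte : t ≠ e)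
    (hdeg : ∀ v ∈ S, v ∉ F → k ≤ deg D S v)
    (hno : ¬ ∃ x ∈ S, x ∉ F ∧ D x e ∧ D x t) :
    k ≤ (S.erase e).card ∧ ∀ v ∈ S, v ∉ F → k ≤ deg (con D e t) (S.erase e) v := by
  have h2 : ∀ v ∈ S, v ∉ F → k ≤ deg (con D e t) (S.erase e) v := fun v hv hvF =>
    (hdeg v hv hvF).trans (deg_con ht hte fun h => hno ⟨v, hv, hvF, h⟩)
  refine ⟨?_, h2⟩
  obtain ⟨v, hv, hvF⟩ : ∃ v ∈ S, v ∉ F.toFinset := by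
    by_contra hcon
    push Not at hcon
    have := Finset.card_le_card (show S ⊆ F.toFinset from hcon)
    have := F.toFinset_card_le
    omega
  exact (h2 v hv (by simpa using hvF)).trans deg_le_card

/-- Conclusion of contraction: smaller state. -/
theorem con_StC {V : Type*} {k : ℕ} {D : V → V → Prop} {S : Finset V} {w : V} {Rs Rs' : List (List V)}
    {u' : List Bool} {e t : V}
    (hk : k ≤ S.card) (hF : (w :: Rs.flatten).length < k) (hnd : (w :: Rs.flatten).Nodup)
    (hS : ∀ x ∈ w :: Rs.flatten, x ∈ S)
    (ht : t ∈ w :: Rs.flatten) (hte : t ≠ e)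
    (hdeg : ∀ v ∈ S, v ∉ w :: Rs.flatten → k ≤ deg D S v)
    (hno : ¬ ∃ x ∈ S, x ∉ w :: Rs.flatten ∧ D x e ∧ D x t)
    (hVal : Val (con D e t) w u' Rs')
    (hperm : (w :: Rs.flatten).Perm (e :: w :: Rs'.flatten)) : StC k (con D e t) (S.erase e) u' := by
  obtain ⟨h1, h2⟩ := con_aux hk hF (hS t ht) hte hdeg hno
  have hnd' := hperm.nodup_iff.1 hnd
  refine ⟨h1, w, Rs', hVal, (List.nodup_cons.1 hnd').2, ?_, ?_⟩
  · intro x hx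
    refine Finset.mem_erase.2 ⟨?_, hS x (hperm.mem_iff.2 (List.mem_cons_of_mem _ hx))⟩
    rintro rfl
    exact (List.nodup_cons.1 hnd').1 hx
  · intro v hv hvF
    have := Finset.mem_erase.1 hv
    refine h2 v this.2 fun h => ?_
    rcases List.mem_cons.1 (hperm.mem_iff.1 h) with h | h
    · exact this.1 h
    · exact hvF h

theorem push_StC {V : Type*} {k : ℕ} {D : V → V → Prop} {S : Finset V} {w : V} {Rs Rs' : List (List V)}
    {u' : List Bool} {x : V}
    (hk : k ≤ S.card) (hnd : (w :: Rs.flatten).Nodup)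
    (hS : ∀ x ∈ w :: Rs.flatten, x ∈ S)
    (hdeg : ∀ v ∈ S, v ∉ w :: Rs.flatten → k ≤ deg D S v)
    (hxS : x ∈ S) (hxF : x ∉ w :: Rs.flatten)
    (hVal : Val D w u' Rs')
    (hperm : (w :: Rs'.flatten).Perm (x :: w :: Rs.flatten)) : StC k D S u' := by
  refine ⟨hk, w, Rs', hVal, hperm.nodup_iff.2 (List.nodup_cons.2 ⟨hxF, hnd⟩), ?_, ?_⟩
  · intro y hy
    rcases List.mem_cons.1 (hperm.mem_iff.1 hy) with h | h
    · exact h ▸ hxS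
    · exact hS y h
  · intro v hv hvF
    exact hdeg v hv fun h => hvF (hperm.mem_iff.2 (List.mem_cons_of_mem _ h))

theorem con_of {V : Type*} {D : V → V → Prop} {e t : V} : ∀ x y, D x y → con D e t x y :=
  fun _ _ h => Or.inl h

theorem step_false {V : Type*} {k : ℕ} {D : V → V → Prop} {S : Finset V} {u : List Bool}
    (hu : u.length + 2 < k) (h : StC k D S u) :
    StC k D S (false :: u) ∨ ∃ e t, e ∈ S ∧ D e t ∧
      (StB k (con D e t) (S.erase e) ∨ ∃ u', StC k (con D e t) (S.erase e) u' ∧ u' = u.tail) := by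
  obtain ⟨hk, w, Rs, hV, hnd, hS, hdeg⟩ := h
  have hF : (w :: Rs.flatten).length < k := by
    rw [List.length_cons, hV.length]; exact hu
  cases hV with
  | base g hg =>
    by_cases hx : ∃ x ∈ S, x ∉ w :: [[g]].flatten ∧ D x g ∧ D x w
    · obtain ⟨x, hxS, hxF, h1, h2⟩ := hx
      left
      refine push_StC (Rs' := [[x], [g]]) hk hnd hS hdeg hxS hxF ?_ ?_
      · exact Val.cons [] x [] g [] [] (Val.base g hg) (by simp) h2 (by simpa using h1)
      · simpa using List.Perm.swap _ _ _
    · right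
      have hgw : w ≠ g := by simpa using hnd
      refine ⟨g, w, hS g (by simp), hg, Or.inl ?_⟩
      obtain ⟨h1, h2⟩ := con_aux hk hF (hS w (by simp)) hgw hdeg hx
      refine ⟨h1, w, Finset.mem_erase.2 ⟨hgw, hS w (by simp)⟩, fun v hv hvw => h2 v (Finset.mem_of_mem_erase hv) ?_⟩
      have := (Finset.mem_erase.1 hv).1
      simp [hvw, this]
  | cons u g R h R' Rs hV hch hg hall =>
    by_cases hx : ∃ x ∈ S, x ∉ w :: ((g :: R) :: (h :: R') :: Rs).flatten ∧ D x g ∧ D x w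
    · obtain ⟨x, hxS, hxF, h1, h2⟩ := hx
      left
      refine push_StC (Rs' := [x] :: (g :: R) :: (h :: R') :: Rs) hk hnd hS hdeg hxS hxF ?_ ?_
      · exact Val.cons _ x [] g R _ (Val.cons u g R h R' Rs hV hch hg hall) (by simp) h2 (by simpa using h1)
      · simpa using List.Perm.swap _ _ _
    · right
      have hgw : w ≠ g := by
        rintro rfl; simp at hnd
      refine ⟨g, w, hS g (by simp), hg, Or.inr ⟨_, ?_, rfl⟩⟩
      cases R with
      | nil =>
        refine con_StC (Rs' := (h :: R') :: Rs) hk hF hnd hS (by simp) hgw hdeg hx ?_ ?_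
        · simpa using hV.mono con_of
        · simpa using List.Perm.swap _ _ _
      | cons r R =>
        refine con_StC (Rs' := (r :: R) :: (h :: R') :: Rs) hk hF hnd hS (by simp) hgw hdeg hx ?_ ?_
        · have hch' := List.isChain_cons_cons.1 hch
          have := Val.cons (D := con D g w) u r R h R' Rs (hV.mono con_of) (hch'.2.imp fun _ _ => con_of _ _)
            (Or.inr ⟨rfl, hch'.1⟩) (fun x hx => con_of _ _ (hall x (List.mem_cons_of_mem _ hx)))
          simpa [List.replicate_succ] using this
        · simpa using List.Perm.swap _ _ _

theorem step_true {V : Type*} {k : ℕ} {D : V → V → Prop} {S : Finset V} {u : List Bool}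
    (hu : u.length + 2 < k) (hne : u ≠ []) (h : StC k D S u) :
    StC k D S (true :: u) ∨ ∃ e t, e ∈ S ∧ D e t ∧
      (StB k (con D e t) (S.erase e) ∨ ∃ u', StC k (con D e t) (S.erase e) u' ∧ u' = u.tail) := by
  obtain ⟨hk, w, Rs, hV, hnd, hS, hdeg⟩ := h
  have hF : (w :: Rs.flatten).length < k := by
    rw [List.length_cons, hV.length]; exact hu
  cases hV with
  | base g hg => exact absurd rfl hne
  | cons u g R h R' Rs hV hch hg hall =>
    obtain ⟨Q, e, hQ⟩ : ∃ Q e, g :: R = Q ++ [e] :=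
      ⟨_, _, (List.dropLast_append_getLast (List.cons_ne_nil g R)).symm⟩
    have hlen : R.length = Q.length := by simpa using congrArg List.length hQ
    have heh : D e h := hall e (by simp [hQ])
    by_cases hx : ∃ x ∈ S, x ∉ w :: ((g :: R) :: (h :: R') :: Rs).flatten ∧ D x e ∧ D x h
    · obtain ⟨x, hxS, hxF, h1, h2⟩ := hx
      left
      refine push_StC (Rs' := (g :: (R ++ [x])) :: (h :: R') :: Rs) hk hnd hS hdeg hxS hxF ?_ ?_
      · have := Val.cons (D := D) (w := w) u g (R ++ [x]) h R' Rs hV ?_ hg ?_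
        · simpa [List.replicate_succ] using this
        · rw [← List.cons_append, hQ, List.append_assoc]
          rw [hQ] at hch
          rw [List.isChain_append] at hch ⊢
          refine ⟨hch.1, by simpa using h1, ?_⟩
          simpa using hch.2.2
        · intro y hy
          rw [← List.cons_append, List.mem_append] at hy
          rcases hy with hy | hy
          · exact hall y hy
          · rw [List.mem_singleton.1 hy]; exact h2
      · have := List.perm_middle (a := x) (l₁ := w :: g :: R) (l₂ := h :: R' ++ Rs.flatten)
        simpa using this
    · right
      have hte : h ≠ e := by
        rintro rfl
        rw [List.flatten_cons, hQ] at hnd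
        simp [List.nodup_append] at hnd
      refine ⟨e, h, hS e (by simp [hQ]), heh, Or.inr ⟨_, ?_, rfl⟩⟩
      cases Q with
      | nil =>
        have : R = [] := by simpa using hlen
        subst this
        have : g = e := by simpa using hQ
        subst this
        refine con_StC (Rs' := (h :: R') :: Rs) hk hF hnd hS (by simp) hte hdeg hx ?_ ?_
        · simpa using hV.mono con_of
        · simpa using List.Perm.swap _ _ _
      | cons g' Q =>
        have : g = g' := by simpa using congrArg List.head? hQ
        subst this
        have hR : R = Q ++ [e] := by simpa using hQ
        refine con_StC (Rs' := (g :: Q) :: (h :: R') :: Rs) hk hF hnd hS (by simp) hte hdeg hx ?_ ?_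
        · rw [hQ] at hch
          have := Val.cons (D := con D e h) u g Q h R' Rs (hV.mono con_of)
            ((List.isChain_append.1 hch).1.imp fun _ _ => con_of _ _)
            (con_of _ _ hg) (fun x hx => con_of _ _ (hall x (by rw [hQ]; exact List.mem_append_left _ hx)))
          simpa [hR, List.replicate_succ] using this
        · subst hR
          simp only [List.flatten_cons]
          have := List.perm_middle (a := e) (l₁ := w :: g :: Q) (l₂ := h :: R' ++ Rs.flatten)
          simpa using this

theorem main_ind_s2 {V : Type*} {ℓ k : ℕ} {σ : ZMod ℓ → Bool} {U U0 : List Bool} (hU : U = U0 ++ [false])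
    (hk : U.length + 2 < k)
    (fin : ∀ (D : V → V → Prop) (S : Finset V) w Rs, Val D w U Rs → (w :: Rs.flatten).Nodup →
      (∀ x ∈ w :: Rs.flatten, x ∈ S) → CS ℓ D S σ) (n : ℕ) :
    ∀ (D : V → V → Prop) (S : Finset V), S.card = n →
      (∀ u, u <:+ U → StC k D S u → CS ℓ D S σ) ∧ (StB k D S → CS ℓ D S σ) ∧
      (StA k D S → CS ℓ D S σ) := by
  induction n using Nat.strong_induction_on with
  | _ n ih =>
  intro D S hn
  have hC : ∀ z u, z ++ u = U → StC k D S u → CS ℓ D S σ := by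
    intro z
    induction z using List.reverseRecOn with
    | nil =>
      rintro u hu ⟨-, w, Rs, h1, h2, h3, -⟩
      rw [List.nil_append] at hu
      subst hu
      exact fin D S w Rs h1 h2 h3
    | append_singleton z c ihz =>
      intro u hu hst
      have hu' : z ++ (c :: u) = U := by rw [← hu]; simp
      have hlen : u.length + 2 < k := by
        have := congrArg List.length hu
        simp at this
        omega
      have key : StC k D S (c :: u) ∨ ∃ e t, e ∈ S ∧ D e t ∧
        (StB k (con D e t) (S.erase e) ∨ ∃ u', StC k (con D e t) (S.erase e) u' ∧ u' = u.tail) := by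
        cases c with
        | false => exact step_false hlen hst
        | true =>
          refine step_true hlen ?_ hst
          rintro rfl
          rw [List.append_nil, hU] at hu
          have := List.append_inj_right' hu rfl
          simp at this
      rcases key with h | ⟨e, t, he, het, h⟩
      · exact ihz (c :: u) hu' h
      · have hlt : (S.erase e).card < n := hn ▸ Finset.card_erase_lt_of_mem he
        have IH := ih _ hlt (con D e t) (S.erase e) rfl
        refine CS.lift he het ?_
        rcases h with h | ⟨u', h, rfl⟩
        · exact IH.2.1 h
        · refine IH.1 _ ?_ h
          exact (List.tail_suffix u).trans ⟨z ++ [c], hu⟩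
  have hB : StB k D S → CS ℓ D S σ := by
    rintro ⟨hkS, w, hw, hdeg⟩
    by_cases hg : ∃ g ∈ S, g ≠ w ∧ D g w
    · obtain ⟨g, hgS, hgw, hD⟩ := hg
      refine hC U [] (by simp) ⟨hkS, w, [[g]], Val.base g hD, by simpa using hgw.symm, ?_, ?_⟩
      · simp [hw, hgS]
      · intro v hv hvF
        exact hdeg v hv fun h => hvF (by simp [h])
    · have hdeg' : ∀ v ∈ S.erase w, k ≤ deg D (S.erase w) v := by
        intro v hv
        obtain ⟨hvw, hvS⟩ := Finset.mem_erase.1 hv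
        refine (hdeg v hvS hvw).trans (Finset.card_le_card ?_)
        intro x hx
        simp only [Finset.mem_filter, Finset.mem_erase] at hx ⊢
        refine ⟨⟨?_, hx.1⟩, hx.2⟩
        rintro rfl
        exact hg ⟨v, hvS, hvw, hx.2⟩
      have hlt : (S.erase w).card < n := hn ▸ Finset.card_erase_lt_of_mem hw
      refine ((ih _ hlt D (S.erase w) rfl).2.2 ⟨?_, hdeg'⟩).mono (Finset.erase_subset _ _)
      have hpos : 0 < (S.erase w).card := by
        rw [Finset.card_erase_of_mem hw]; omega
      obtain ⟨v, hv⟩ := Finset.card_pos.1 hpos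
      exact (hdeg' v hv).trans deg_le_card
  refine ⟨fun u hu => ?_, hB, ?_⟩
  · obtain ⟨z, hz⟩ := hu
    exact hC z u hz
  · rintro ⟨hkS, hdeg⟩
    obtain ⟨w, hw⟩ : S.Nonempty := Finset.card_pos.1 (by omega)
    exact hB ⟨hkS, w, hw, fun v hv _ => hdeg v hv⟩

/-- arcs along the flattened state -/
def AlongW {V : Type*} (D : V → V → Prop) (u : List Bool) (l : List V) : Prop :=
  ∀ i (x y : V) (b : Bool), u[i]? = some b → l[i]? = some x → l[i+1]? = some y →
    if b = true then D y x else D x y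

theorem Val.along {V : Type*} {D : V → V → Prop} {w : V}
    {u : List Bool} {Rs : List (List V)} (h : Val D w u Rs) :
    AlongW D u Rs.flatten ∧ (∀ x, Rs.flatten[0]? = some x → D x w) ∧
      (∀ x, Rs.flatten[u.length]? = some x → D x w) := by
  induction h with
  | base g h => 
    refine ⟨?_, ?_, ?_⟩
    · intro i x y b hb; simp at hb
    · intro x hx; simp at hx; exact hx ▸ h
    · intro x hx; simp at hx; exact hx ▸ h
  | cons u g R h R' Rs hV hch hg hall ih =>
    obtain ⟨ih1, ih2, ih3⟩ := ih
    rw [List.flatten_cons]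
    refine ⟨?_, ?_, ?_⟩
    · intro i x y b hb hx hy
      rcases lt_trichotomy i R.length with hi | hi | hi
      · rw [List.getElem?_append_left (by simpa using hi), List.getElem?_replicate, if_pos hi] at hb
        rw [List.getElem?_append_left (by simp; omega)] at hx hy
        rw [List.isChain_iff_getElem] at hch
        have := hch i (by simpa using hi)
        obtain ⟨_, hx⟩ := List.getElem?_eq_some_iff.1 hx
        obtain ⟨_, hy⟩ := List.getElem?_eq_some_iff.1 hy
        have hb : true = b := by simpa using hb
        subst hb
        rw [if_pos rfl, ← hx, ← hy]; exact this
      · subst hi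
        rw [List.getElem?_append_right (by simp)] at hb
        have hb : false = b := by simpa using hb
        subst hb
        rw [List.getElem?_append_left (by simp)] at hx
        rw [List.getElem?_append_right (by simp)] at hy
        have hy : h = y := by simpa using hy
        subst hy
        simpa using hall x (List.mem_of_getElem? hx)
      · obtain ⟨j, rfl⟩ : ∃ j, i = R.length + 1 + j := ⟨i - (R.length + 1), by omega⟩
        rw [List.getElem?_append_right (by simp; omega)] at hb
        rw [List.getElem?_append_right (by simp)] at hx
        rw [List.getElem?_append_right (by simp; omega)] at hy
        refine ih1 j x y b ?_ ?_ ?_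
        · rw [List.length_replicate, show R.length + 1 + j - R.length = j + 1 by omega] at hb
          simpa using hb
        · rw [List.length_cons, show R.length + 1 + j - (R.length+1) = j by omega] at hx
          exact hx
        · rw [List.length_cons, show R.length + 1 + j + 1 - (R.length+1) = j + 1 by omega] at hy
          exact hy
    · intro x hx
      have : g = x := by simpa using hx
      exact this ▸ hg
    · intro x hx
      refine ih3 x ?_
      rw [List.getElem?_append_right (by simp)] at hx
      simpa [show R.length + (u.length + 1) - (R.length + 1) = u.length by omega] using hx

theorem fin_case {V : Type*} {m : ℕ} {σ : ZMod (m + 2) → Bool} (h0 : σ 0 = false)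
    (h1 : σ ((m + 1 : ℕ) : ZMod (m + 2)) = true) (D : V → V → Prop) (S : Finset V) (w : V)
    (Rs : List (List V))
    (hV : Val D w ((List.range (m + 1)).map (fun i => σ ((m - i : ℕ) : ZMod (m + 2)))) Rs)
    (hnd : (w :: Rs.flatten).Nodup) (hS : ∀ x ∈ w :: Rs.flatten, x ∈ S) : CS (m + 2) D S σ := by
  obtain ⟨a1, a2, a3⟩ := hV.along
  have hlen := hV.length
  generalize Rs.flatten = l at *
  simp only [List.length_map, List.length_range] at hlen a3
  obtain ⟨G, hG⟩ : ∃ G : ℕ → V, ∀ n, n ≤ m + 1 → l[m + 1 - n]? = some (G n) :=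
    ⟨fun n => (l[m + 1 - n]?).getD w, fun n hn => by
      dsimp only; rw [List.getElem?_eq_getElem (by omega)]; simp⟩
  have hGl : ∀ n, n ≤ m + 1 → G n ∈ l := fun n hn => List.mem_of_getElem? (hG n hn)
  have hGw : ∀ n, n ≤ m + 1 → G n ≠ w := fun n hn h =>
    (List.nodup_cons.1 hnd).1 (h ▸ hGl n hn)
  have hGinj : ∀ i j, i ≤ m + 1 → j ≤ m + 1 → G i = G j → i = j := by
    intro i j hi hj h
    have hi' := hG i hi
    have hj' := hG j hj
    rw [h, ← hj'] at hi'
    have := (List.getElem?_inj (by omega) (List.nodup_cons.1 hnd).2).1 hi'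
    omega
  have hGS : ∀ n, n ≤ m + 1 → G n ∈ S := fun n hn => hS _ (List.mem_cons_of_mem _ (hGl n hn))
  have harc : ∀ j, j ≤ m → if σ (j : ZMod (m+2)) = true then D (G j) (G (j+1)) else D (G (j+1)) (G j) := by
    intro j hj
    have := a1 (m - j) (G (j+1)) (G j) (σ (j : ZMod (m+2))) ?_ ?_ ?_
    · exact this
    · rw [List.getElem?_map, List.getElem?_range (by omega)]
      simp [show m - (m - j) = j by omega]
    · rw [← hG (j+1) (by omega)]; congr 1; omega
    · rw [← hG j (by omega)]; congr 1; omega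
  have hG0 : D (G 0) w := a3 _ (by rw [← hG 0 (by omega)]; simp)
  have hG1 : D (G (m+1)) w := a2 _ (by rw [← hG (m+1) (by omega)]; simp)
  have hval : ∀ x : ZMod (m + 2), x.val ≤ m + 1 := fun x => by
    have := ZMod.val_lt x; omega
  have hcast : ∀ j, j ≤ m + 1 → ((j : ℕ) : ZMod (m+2)).val = j := fun j hj =>
    ZMod.val_natCast_of_lt (by omega)
  have hvinj : ∀ x y : ZMod (m + 2), x.val = y.val → x = y := fun x y h => ZMod.val_injective _ h
  obtain ⟨φ, hφ⟩ : ∃ φ : ZMod (m+2) → V, φ = fun x => if x.val = 0 then w else G x.val := ⟨_, rfl⟩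
  have hφ0 : φ 0 = w := by simp [hφ]
  have hφj : ∀ j, 1 ≤ j → j ≤ m + 1 → φ ((j : ℕ) : ZMod (m+2)) = G j := by
    intro j hj hj'
    rw [hφ]; dsimp only; rw [hcast j hj', if_neg (by omega)]
  refine ⟨φ, fun x => if x.val = 0 then [G 0] else [], ?_, ?_, ?_, ?_, ?_, ?_⟩
  · intro x y hxy
    rw [hφ] at hxy
    dsimp only at hxy
    apply hvinj
    split_ifs at hxy with h1 h2 h2
    · omega
    · exact absurd hxy.symm (hGw _ (hval y))
    · exact absurd hxy (hGw _ (hval x))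
    · exact hGinj _ _ (hval x) (hval y) hxy
  · intro x
    rw [hφ]; dsimp only
    split_ifs
    · exact hS w (by simp)
    · exact hGS _ (hval x)
  · intro x
    obtain ⟨j, hj, rfl⟩ : ∃ j, j ≤ m + 1 ∧ x = ((j : ℕ) : ZMod (m+2)) :=
      ⟨x.val, hval x, (ZMod.natCast_zmod_val x).symm⟩
    dsimp only
    rw [hcast j hj]
    rcases Nat.eq_zero_or_pos j with rfl | hpos
    · have := harc 0 (by omega)
      simp only [Nat.cast_zero, h0] at this
      have e1 : φ (sIx σ 0) = G 1 := by
        rw [← hφj 1 le_rfl (by omega)]; simp [sIx, h0]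
      have e2 : φ (tIx σ 0) = w := by
        rw [← hφ0]; simp [tIx, h0]
      simp only [Nat.cast_zero, e1, e2, if_true]
      simp only [List.cons_append, List.nil_append, List.isChain_cons_cons, List.isChain_singleton, and_true]
      exact ⟨by simpa using this, hG0⟩
    · rw [if_neg (by omega)]
      simp only [List.nil_append, List.isChain_cons_cons, List.isChain_singleton, and_true]
      rcases Nat.lt_or_ge m j with hm | hm
      · obtain rfl : j = m + 1 := by omega
        have e1 : sIx σ ((m + 1 : ℕ) : ZMod (m+2)) = ((m + 1 : ℕ) : ZMod (m+2)) := by simp only [sIx, h1, if_true]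
        have e2 : tIx σ ((m + 1 : ℕ) : ZMod (m+2)) = 0 := by
          simp only [tIx, h1, if_true]
          have := ZMod.natCast_self (m+2)
          rw [← this]; push_cast; ring
        rw [e1, e2, hφ0, hφj _ hpos hj]
        exact hG1
      · have := harc j hm
        have e3 : ((j : ℕ) : ZMod (m+2)) + 1 = ((j + 1 : ℕ) : ZMod (m+2)) := by push_cast; ring
        have p1 := hφj j hpos hj
        have p2 := hφj (j+1) (by omega) (by omega)
        by_cases hs : σ ((j : ℕ) : ZMod (m+2)) = true
        · rw [if_pos hs] at this
          simp only [sIx, tIx, if_pos hs, e3, p1, p2]; exact this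
        · rw [if_neg hs] at this
          simp only [sIx, tIx, if_neg hs, e3, p1, p2]; exact this
  · intro x; dsimp only; split_ifs <;> simp
  · intro x y hy
    dsimp only at hy
    split_ifs at hy
    · rw [List.mem_singleton] at hy
      subst hy
      refine ⟨hGS 0 (by omega), fun z hz => ?_⟩
      rw [hφ] at hz
      dsimp only at hz
      split_ifs at hz with h
      · exact hGw 0 (by omega) hz.symm
      · exact h (hGinj _ _ (hval z) (by omega) hz)
    · simp at hy
  · intro x y hxy z hz hz'
    dsimp only at hz hz'
    split_ifs at hz hz' with h2 h3
    · exact hxy (hvinj _ _ (h2.trans h3.symm))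
    all_goals simp at hz hz'

theorem nonconst_case {V : Type*} {m k : ℕ} {σ : ZMod (m + 2) → Bool} (h0 : σ 0 = false)
    (h1 : σ ((m + 1 : ℕ) : ZMod (m + 2)) = true) (D : V → V → Prop) (S : Finset V)
    (hk : m + 3 < k) (hS : StA k D S) : CS (m + 2) D S σ := by
  refine (main_ind_s2 (k := k) (U := (List.range (m + 1)).map (fun i => σ ((m - i : ℕ) : ZMod (m + 2))))
    (U0 := (List.range m).map (fun i => σ ((m - i : ℕ) : ZMod (m + 2)))) ?_ ?_ ?_ S.card D S rfl).2.2 hS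
  · rw [List.range_succ]; simp [h0]
  · simpa using hk
  · intro D S w Rs hV h2 h3
    exact fin_case h0 h1 D S w Rs hV h2 h3

theorem CS.rot {V : Type*} {ℓ : ℕ} {D : V → V → Prop} {S : Finset V} {σ : ZMod ℓ → Bool} (c : ZMod ℓ)
    (h : CS ℓ D S (fun x => σ (x + c))) : CS ℓ D S σ := by
  obtain ⟨φ, I, h1, h2, h3, h4, h5, h6⟩ := h
  refine ⟨fun x => φ (x - c), fun x => I (x - c), ?_, fun i => h2 _, ?_, fun i => h4 _, ?_, ?_⟩
  · intro x y h; exact sub_left_injective (h1 h)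
  · intro i
    have := h3 (i - c)
    have e1 : sIx (fun x => σ (x + c)) (i - c) = sIx σ i - c := by
      simp only [sIx, sub_add_cancel]; split_ifs <;> ring
    have e2 : tIx (fun x => σ (x + c)) (i - c) = tIx σ i - c := by
      simp only [tIx, sub_add_cancel]; split_ifs <;> ring
    rw [e1, e2] at this
    exact this
  · intro i x hx
    exact ⟨(h5 _ x hx).1, fun j => (h5 _ x hx).2 _⟩
  · intro i j hij
    exact h6 _ _ fun h => hij (sub_left_injective h)

theorem CS.flip {V : Type*} {ℓ : ℕ} {D : V → V → Prop} {S : Finset V} {σ : ZMod ℓ → Bool}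
    (h : CS ℓ D S (fun x => !σ (-x - 1))) : CS ℓ D S σ := by
  obtain ⟨φ, I, h1, h2, h3, h4, h5, h6⟩ := h
  refine ⟨fun x => φ (-x), fun x => I (-x - 1), ?_, fun i => h2 _, ?_, fun i => h4 _, ?_, ?_⟩
  · intro x y h; exact neg_injective (h1 h)
  · intro i
    have := h3 (-i - 1)
    have e0 : -(-i - 1) - 1 = i := by ring
    have e1 : sIx (fun x => !σ (-x - 1)) (-i - 1) = - sIx σ i := by
      simp only [sIx, e0]; cases σ i <;> simp <;> ring
    have e2 : tIx (fun x => !σ (-x - 1)) (-i - 1) = - tIx σ i := by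
      simp only [tIx, e0]; cases σ i <;> simp <;> ring
    rw [e1, e2] at this
    exact this
  · intro i x hx
    exact ⟨(h5 _ x hx).1, fun j => (h5 _ x hx).2 _⟩
  · intro i j hij
    exact h6 _ _ fun h => hij (neg_injective (sub_left_injective h))

theorem const_aux {V : Type*} {m : ℕ} (D : V → V → Prop) (S : Finset V) (y0 y : V) (T A : List V)
    (hT : T.length = m + 2) (hy0 : T[0]? = some y0) (hnd : (T ++ (A ++ [y])).Nodup)
    (hch : List.IsChain (fun a b => D b a) (T ++ (A ++ [y])))
    (hS : ∀ x ∈ T ++ (A ++ [y]), x ∈ S) (hD : D y0 y) :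
    CS (m + 2) D S (fun _ => false) := by
  obtain ⟨F, hF⟩ : ∃ F : ℕ → V, ∀ n, n ≤ m + 1 → T[n]? = some (F n) :=
    ⟨fun n => (T[n]?).getD y, fun n hn => by
      dsimp only; rw [List.getElem?_eq_getElem (by omega)]; simp⟩
  have hFT : ∀ n, n ≤ m + 1 → F n ∈ T := fun n hn => List.mem_of_getElem? (hF n hn)
  obtain ⟨n1, n2, n3⟩ := List.nodup_append.1 hnd
  obtain ⟨c1, c2, c3⟩ := List.isChain_append.1 hch
  have hFinj : ∀ i j, i ≤ m + 1 → j ≤ m + 1 → F i = F j → i = j := by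
    intro i j hi hj h
    have hi' := hF i hi
    rw [h, ← hF j hj] at hi'
    exact (List.getElem?_inj (by omega) n1).1 hi'
  have harc : ∀ j, j ≤ m → D (F (j+1)) (F j) := by
    intro j hj
    rw [List.isChain_iff_getElem] at c1
    have := c1 j (by omega)
    obtain ⟨_, hx⟩ := List.getElem?_eq_some_iff.1 (hF j (by omega))
    obtain ⟨_, hy⟩ := List.getElem?_eq_some_iff.1 (hF (j+1) (by omega))
    rw [← hx, ← hy]; exact this
  have hF0 : F 0 = y0 := by
    have := hF 0 (by omega); rw [hy0] at this; simpa using this.symm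
  have hlast : T.getLast? = some (F (m+1)) := by
    rw [List.getLast?_eq_getElem?, hT, ← hF (m+1) le_rfl]; rfl
  have hlong : List.IsChain D (y0 :: ((A ++ [y]).reverse ++ [F (m+1)])) := by
    have h1 : List.IsChain (fun a b => D b a) (F (m+1) :: (A ++ [y])) := by
      rw [List.isChain_cons]
      exact ⟨fun z hz => c3 _ hlast z hz, c2⟩
    have h2 := List.isChain_reverse.2 h1
    rw [List.reverse_cons] at h2
    rw [List.isChain_cons]
    refine ⟨?_, h2⟩
    intro z hz
    have : y = z := by simpa using hz
    exact this ▸ hD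
  have hval : ∀ x : ZMod (m + 2), x.val ≤ m + 1 := fun x => by
    have := ZMod.val_lt x; omega
  have hcast : ∀ j, j ≤ m + 1 → ((j : ℕ) : ZMod (m+2)).val = j := fun j hj =>
    ZMod.val_natCast_of_lt (by omega)
  have hvinj : ∀ x y : ZMod (m + 2), x.val = y.val → x = y := fun x y h => ZMod.val_injective _ h
  refine ⟨fun x => F x.val, fun x => if x.val = m + 1 then (A ++ [y]).reverse else [], ?_, ?_, ?_, ?_, ?_, ?_⟩
  · intro a b hab
    exact hvinj _ _ (hFinj _ _ (hval a) (hval b) hab)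
  · intro x; exact hS _ (List.mem_append_left _ (hFT _ (hval x)))
  · intro x
    obtain ⟨j, hj, rfl⟩ : ∃ j, j ≤ m + 1 ∧ x = ((j : ℕ) : ZMod (m+2)) :=
      ⟨x.val, hval x, (ZMod.natCast_zmod_val x).symm⟩
    have e3 : ((j : ℕ) : ZMod (m+2)) + 1 = ((j + 1 : ℕ) : ZMod (m+2)) := by push_cast; ring
    simp only [sIx, tIx, Bool.false_eq_true, if_false, e3, hcast j hj]
    rcases Nat.lt_or_ge m j with hm | hm
    · obtain rfl : j = m + 1 := by omega
      have := ZMod.natCast_self (m+2)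
      rw [if_pos rfl, this, ZMod.val_zero, hF0]
      exact hlong
    · rw [if_neg (by omega), hcast (j+1) (by omega)]
      simpa using harc j hm
  · intro x; dsimp only
    split_ifs
    · exact List.nodup_reverse.2 n2
    · simp
  · intro x z hz
    dsimp only at hz
    split_ifs at hz
    · rw [List.mem_reverse] at hz
      exact ⟨hS _ (List.mem_append_right _ hz), fun j => n3 _ (hFT _ (hval j)) _ hz⟩
    · simp at hz
  · intro a b hab z hz hz'
    dsimp only at hz hz'
    split_ifs at hz hz' with h2 h3
    · exact hab (hvinj _ _ (h2.trans h3.symm))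
    all_goals simp at hz hz'

theorem const_case {V : Type*} {m k : ℕ} (D : V → V → Prop) (S : Finset V)
    (hk : m + 3 < k) (hS : StA k D S) : CS (m + 2) D S (fun _ => false) := by
  by_contra hno
  have key : ∀ n, ∃ (y0 : V) (l : List V), l.length = n ∧ (y0 :: l).Nodup ∧
      List.IsChain (fun a b => D b a) (y0 :: l) ∧ ∀ x ∈ y0 :: l, x ∈ S := by
    intro n
    induction n with
    | zero =>
      obtain ⟨w, hw⟩ : S.Nonempty := Finset.card_pos.1 (by have := hS.1; omega)
      exact ⟨w, [], rfl, by simp, by simp, by simpa using hw⟩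
    | succ n ih =>
      obtain ⟨y0, l, h1, h2, h3, h4⟩ := ih
      by_cases hx : ∃ x ∈ S, x ∉ y0 :: l ∧ D y0 x
      · obtain ⟨x, hxS, hxl, hD⟩ := hx
        refine ⟨x, y0 :: l, by simp [h1], List.nodup_cons.2 ⟨hxl, h2⟩,
          List.isChain_cons_cons.2 ⟨hD, h3⟩, ?_⟩
        intro z hz
        rcases List.mem_cons.1 hz with h | h
        · exact h ▸ hxS
        · exact h4 z h
      · exfalso
        push Not at hx
        obtain ⟨y, hy, hyt⟩ : ∃ y ∈ S.filter (fun x => D y0 x), y ∉ ((y0 :: l).take (m+2)).toFinset := by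
          by_contra hcon
          push Not at hcon
          have c1 := Finset.card_le_card (show S.filter (fun x => D y0 x) ⊆ _ from hcon)
          have c2 := ((y0 :: l).take (m+2)).toFinset_card_le
          have c3 := hS.2 y0 (h4 y0 (by simp))
          have c4 := List.length_take_le (m+2) (y0 :: l)
          unfold deg at c3
          omega
        rw [Finset.mem_filter] at hy
        have hyl : y ∈ y0 :: l := by
          by_contra h
          exact hx y hy.1 h hy.2
        have hsplit := List.take_append_drop (m+2) (y0 :: l)
        rw [← hsplit, List.mem_append] at hyl
        have hyd := hyl.resolve_left (fun h => hyt (List.mem_toFinset.2 h))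
        obtain ⟨A, B, hAB⟩ := List.append_of_mem hyd
        have hlen : m + 2 < (y0 :: l).length := by
          by_contra hcon
          rw [List.drop_eq_nil_of_le (by omega)] at hyd
          simp at hyd
        have heq : y0 :: l = ((y0 :: l).take (m+2) ++ (A ++ [y])) ++ B := by
          conv_lhs => rw [← hsplit, hAB]
          simp
        rw [heq] at h2 h3 h4
        refine hno (const_aux D S y0 y ((y0 :: l).take (m+2)) A ?_ ?_ ?_ ?_ ?_ hy.2)
        · rw [List.length_take]; omega
        · simp
        · exact (List.nodup_append.1 h2).1
        · exact (List.isChain_append.1 h3).1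
        · intro x hx; exact h4 x (List.mem_append_left _ hx)
  obtain ⟨y0, l, h1, h2, -, h4⟩ := key S.card
  have := List.toFinset_card_of_nodup h2
  have h5 := Finset.card_le_card (show (y0 :: l).toFinset ⊆ S from fun x hx => h4 x (List.mem_toFinset.1 hx))
  rw [this, List.length_cons] at h5
  omega

theorem CS_all {V : Type*} {m k : ℕ} (D : V → V → Prop) (S : Finset V)
    (hk : m + 3 < k) (hS : StA k D S) (σ : ZMod (m + 2) → Bool) : CS (m + 2) D S σ := by
  by_cases hc : ∃ i, σ i = true ∧ σ (i + 1) = false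
  · obtain ⟨i, h1, h2⟩ := hc
    refine CS.rot (i + 1) (nonconst_case (k := k) ?_ ?_ D S hk hS)
    · simpa using h2
    · have := ZMod.natCast_self (m+2)
      rw [← h1]; congr 1
      push_cast at this ⊢
      linear_combination this
  · push Not at hc
    by_cases ht : ∃ i, σ i = true
    · obtain ⟨i, hi⟩ := ht
      have hall : ∀ n : ℕ, σ (i + n) = true := by
        intro n
        induction n with
        | zero => simpa using hi
        | succ n ih =>
          have := hc _ ih
          rw [show i + ((n + 1 : ℕ) : ZMod (m+2)) = i + n + 1 by push_cast; ring]
          simpa using this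
      have : ∀ x, σ x = true := fun x => by
        have := hall (x - i).val
        rw [ZMod.natCast_zmod_val] at this
        simpa using this
      apply CS.flip
      simp only [this, Bool.not_true]
      exact const_case D S hk hS
    · push Not at ht
      have : σ = fun _ => false := by
        funext x; simpa using ht x
      rw [this]
      exact const_case D S hk hS

theorem CS.contains {V : Type*} {ℓ : ℕ} (hℓ : 2 ≤ ℓ) {D : V → V → Prop} {S : Finset V}
    {σ : ZMod ℓ → Bool} (h : CS ℓ D S σ) : ContainsSubdivisionOf D (CycleOrientation ℓ σ) := by
  obtain ⟨φ, I, h1, -, h3, h4, h5, h6⟩ := h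
  have hix : ∀ x y, ∃ i, CycleOrientation ℓ σ x y → sIx σ i = x ∧ tIx σ i = y := by
    intro x y
    by_cases hxy : CycleOrientation ℓ σ x y
    · rcases hxy with ⟨hs, he⟩ | ⟨hs, he⟩
      · exact ⟨x, fun _ => by simp [sIx, tIx, hs, he]⟩
      · exact ⟨y, fun _ => by simp [sIx, tIx, hs, he]⟩
    · exact ⟨x, fun h => absurd h hxy⟩
  choose ix hix using hix
  have htd : ∀ (a b : V) (l : List V), (a :: (l ++ [b])).tail.dropLast = l := by
    intro a b l; simp
  refine ⟨φ, fun x y => φ x :: (I (ix x y) ++ [φ y]), h1, ?_, ?_⟩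
  · intro x y hxy
    obtain ⟨e1, e2⟩ := hix x y hxy
    have hch := h3 (ix x y)
    have hne := sIx_ne_tIx hℓ σ (ix x y)
    rw [e1, e2] at hch hne
    refine ⟨⟨by simp, ?_, hch⟩, by simp, ?_, by simp, ?_⟩
    · rw [List.nodup_cons, List.nodup_append, List.mem_append, List.mem_singleton, not_or]
      refine ⟨⟨fun h => (h5 _ _ h).2 x rfl, fun h => hne (h1 h)⟩, h4 _, by simp, ?_⟩
      intro a ha b hb hab
      rw [List.mem_singleton] at hb
      subst hab; exact (h5 _ _ ha).2 y hb.symm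
    · dsimp only; rw [← List.cons_append, List.getLast?_append]; simp
    · intro z hz
      rw [htd] at hz
      exact (h5 _ _ hz).2
  · intro x y x' y' hxy hxy' hne z hz hz'
    rw [htd] at hz
    obtain ⟨e1, e2⟩ := hix x y hxy
    obtain ⟨f1, f2⟩ := hix x' y' hxy'
    rw [List.mem_cons, List.mem_append, List.mem_singleton] at hz'
    rcases hz' with h | h | h
    · exact (h5 _ _ hz).2 _ h.symm
    · refine h6 _ _ ?_ z hz h
      intro heq
      apply hne
      rw [heq] at e1 e2
      exact Prod.ext (e1.symm.trans f1) (e2.symm.trans f2)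
    · exact (h5 _ _ hz).2 _ h.symm


end Aux

/-- There are absolute constants `C > 0` and `d` such that for every
`ℓ ≥ 2`, every digraph with minimum out-degree at least `C·ℓ^d` contains a subdivision
of every orientation of the cycle of length `ℓ`. -/
theorem stmt_2 :
    ∃ C d : ℕ, 0 < C ∧
      ∀ ℓ : ℕ, 2 ≤ ℓ →
        ∀ (V : Type) [Fintype V] [Nonempty V] (D : V → V → Prop),
          (∀ v, ¬ D v v) → (∀ v, C * ℓ ^ d ≤ outDeg D v) →
          ∀ σ : ZMod ℓ → Bool, ContainsSubdivisionOf D (CycleOrientation ℓ σ) := by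
  refine ⟨4, 1, by norm_num, ?_⟩
  intro ℓ hℓ V _ _ D _ hdeg σ
  obtain ⟨m, rfl⟩ : ∃ m, ℓ = m + 2 := ⟨ℓ - 2, by omega⟩
  have hd : ∀ v, 4 * (m + 2) ^ 1 ≤ deg D Finset.univ v := by
    intro v
    refine (hdeg v).trans (le_of_eq ?_)
    unfold outDeg deg
    rw [← Set.ncard_coe_finset]
    congr 1
    ext x
    simp
  refine CS.contains hℓ (CS_all (k := 4 * (m + 2) ^ 1) D Finset.univ (by rw [pow_one]; omega) ⟨?_, fun v _ => hd v⟩ σ)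
  obtain ⟨v⟩ := (inferInstance : Nonempty V)
  exact (hd v).trans deg_le_card

end Paper
end
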